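/- arXiv:1803.06922 — 4 statements merged into one kernel-verified Lean document; each statement's English description precedes it below -/
import Mathlib

section
/- Let (Z_1,Z_2) be jointly Gaussian with Z_i ~ N(\mu_i,\sigma_i^2) (\sigma_i>0) and correlation \rho \in (-1,1), and set u_p = \Phi^{-1}(p), \beta = (\mu_2-\mu_1)/\sigma_1. If \sigma_2 > \rho\sigma_1 and \sigma_1 > \rho\sigma_2, then as p \uparrow 1 the marginal mean excess satisfies E(p) \sim (\sigma_1/(h_1^2 h_2)) \sqrt{2\pi}\, u_p^{-2} e^{u_p^2/2} \varphi_\rho(\sigma_2 u_p/\sigma_1 + \beta, u_p), where h_1 = (\sigma_2-\rho\sigma_1)/(\sigma_1(1-\rho^2)) > 0 and h_2 = (\sigma_1-\rho\sigma_2)/(\sigma_1(1-\rho^2)) > 0; in particular E(p) \to 0 as p \uparrow 1. -/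
open MeasureTheory ProbabilityTheory Filter
open scoped Topology ENNReal

noncomputable section

/-- The standard normal distribution function `Φ`. -/
def stdNormalCDF (x : ℝ) : ℝ := (gaussianReal 0 1 (Set.Iic x)).toReal

/-- The standard normal quantile function `Φ⁻¹`. -/
def stdNormalQuantile (p : ℝ) : ℝ := sInf {x : ℝ | p ≤ stdNormalCDF x}

/-- The standard normal density `φ = Φ'`. -/
def stdNormalPDF (x : ℝ) : ℝ := (Real.sqrt (2 * Real.pi))⁻¹ * Real.exp (-x ^ 2 / 2)

/-- The density `φ_ρ` of a centered bivariate Gaussian vector with unit variances and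
correlation `ρ`. -/
def biStdGaussPDF (ρ : ℝ) (x y : ℝ) : ℝ :=
  (2 * Real.pi * Real.sqrt (1 - ρ ^ 2))⁻¹ *
    Real.exp (-(x ^ 2 - 2 * ρ * x * y + y ^ 2) / (2 * (1 - ρ ^ 2)))

/-- The density of a bivariate Gaussian vector with means `μ1, μ2`, standard deviations
`σ1, σ2` and correlation `ρ`. -/
def biGaussPDF (μ1 μ2 σ1 σ2 ρ : ℝ) (z : ℝ × ℝ) : ℝ :=
  (σ1 * σ2)⁻¹ * biStdGaussPDF ρ ((z.1 - μ1) / σ1) ((z.2 - μ2) / σ2)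

/-- The Value-at-Risk (quantile function) of `Z` at level `p`. -/
def VaR {Ω : Type*} [MeasurableSpace Ω] (P : Measure Ω) (Z : Ω → ℝ) (p : ℝ) : ℝ :=
  sInf {x : ℝ | p ≤ (P {ω | Z ω ≤ x}).toReal}

/-- The marginal mean excess `E(p) = E[(Z₁ - VaR_{Z₂}(p))₊ | Z₂ > VaR_{Z₂}(p)]`. -/
def mme2 {Ω : Type*} [MeasurableSpace Ω] (P : Measure Ω) (Z1 Z2 : Ω → ℝ) (p : ℝ) : ℝ :=
  (∫ ω in {ω | VaR P Z2 p < Z2 ω}, max (Z1 ω - VaR P Z2 p) 0 ∂P) /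
    (P {ω | VaR P Z2 p < Z2 ω}).toReal

/-- The marginal expected shortfall `S(p) = E[Z₁ | Z₂ > VaR_{Z₂}(p)]`. -/
def mes2 {Ω : Type*} [MeasurableSpace Ω] (P : Measure Ω) (Z1 Z2 : Ω → ℝ) (p : ℝ) : ℝ :=
  (∫ ω in {ω | VaR P Z2 p < Z2 ω}, Z1 ω ∂P) / (P {ω | VaR P Z2 p < Z2 ω}).toReal

/-- `(Z₁,Z₂)` is, under `P`, bivariate Gaussian with marginals `N(μᵢ,σᵢ²)` and
correlation `ρ`. -/
def IsBiGaussian {Ω : Type*} [MeasurableSpace Ω] (P : Measure Ω) (Z1 Z2 : Ω → ℝ)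
    (μ1 μ2 σ1 σ2 ρ : ℝ) : Prop :=
  Measure.map (fun ω => (Z1 ω, Z2 ω)) P =
    (volume : Measure (ℝ × ℝ)).withDensity fun z => ENNReal.ofReal (biGaussPDF μ1 μ2 σ1 σ2 ρ z)


lemma aux_map (v1 v2 : ℝ) {c1 c2 : ℝ} (h1 : 0 < c1) (h2 : 0 < c2) :
    Measure.map (fun z : ℝ × ℝ => (v1 + c1 * z.1, v2 + c2 * z.2)) volume
      = ENNReal.ofReal ((c1 * c2)⁻¹) • (volume : Measure (ℝ × ℝ)) := by
  have key : ∀ (v : ℝ) {c : ℝ}, 0 < c → Measure.map (fun x : ℝ => v + c * x) volume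
      = ENNReal.ofReal (c⁻¹) • (volume : Measure ℝ) := by
    intro v c hc
    have : (fun x : ℝ => v + c * x) = (fun x => v + x) ∘ (fun x => c * x) := rfl
    rw [this, ← Measure.map_map (by fun_prop) (by fun_prop), Real.map_volume_mul_left hc.ne',
      Measure.map_smul, map_add_left_eq_self, abs_of_pos (by positivity)]
  have : (fun z : ℝ × ℝ => (v1 + c1 * z.1, v2 + c2 * z.2))
    = Prod.map (fun x => v1 + c1 * x) (fun x => v2 + c2 * x) := rfl
  rw [this, Measure.volume_eq_prod, ← Measure.map_prod_map _ _ (by fun_prop) (by fun_prop),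
    key v1 h1, key v2 h2, Measure.prod_smul_left, Measure.prod_smul_right, smul_smul,
    ← ENNReal.ofReal_mul (by positivity), mul_inv]

lemma aux_chg (v1 v2 : ℝ) {c1 c2 : ℝ} (h1 : 0 < c1) (h2 : 0 < c2) (g : ℝ × ℝ → ℝ)
    (hg : Measurable g) :
    ∫ z, g z = c1 * c2 * ∫ z : ℝ × ℝ, g (v1 + c1 * z.1, v2 + c2 * z.2) := by
  have := integral_map (μ := (volume : Measure (ℝ × ℝ)))
    (φ := fun z : ℝ × ℝ => (v1 + c1 * z.1, v2 + c2 * z.2)) (by fun_prop)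
    (f := g) hg.aestronglyMeasurable
  rw [← this, aux_map v1 v2 h1 h2, integral_smul_measure, ENNReal.toReal_ofReal (by positivity)]
  simp only [smul_eq_mul]
  field_simp

lemma aux_factor (μ1 μ2 σ1 σ2 ρ : ℝ) (hσ1 : 0 < σ1) (hσ2 : 0 < σ2) (hρ : 0 < 1 - ρ ^ 2)
    (x y : ℝ) :
    biGaussPDF μ1 μ2 σ1 σ2 ρ (x, y) = gaussianPDFReal μ2 (Real.toNNReal (σ2 ^ 2)) y *
      gaussianPDFReal (μ1 + ρ * σ1 * ((y - μ2) / σ2)) (Real.toNNReal (σ1 ^ 2 * (1 - ρ ^ 2))) x := by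
  unfold biGaussPDF biStdGaussPDF gaussianPDFReal
  rw [Real.coe_toNNReal _ (by positivity), Real.coe_toNNReal _ (by positivity)]
  have e1 : Real.sqrt (2 * Real.pi * σ2 ^ 2) = Real.sqrt (2 * Real.pi) * σ2 := by
    rw [Real.sqrt_mul (by positivity), Real.sqrt_sq hσ2.le]
  have e2 : Real.sqrt (2 * Real.pi * (σ1 ^ 2 * (1 - ρ ^ 2)))
      = Real.sqrt (2 * Real.pi) * (σ1 * Real.sqrt (1 - ρ ^ 2)) := by
    rw [Real.sqrt_mul (by positivity) (σ1 ^ 2 * (1 - ρ ^ 2)), Real.sqrt_mul (by positivity) (1 - ρ ^ 2),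
      Real.sqrt_sq hσ1.le]
  rw [e1, e2]
  have e3 : Real.sqrt (2 * Real.pi) * Real.sqrt (2 * Real.pi) = 2 * Real.pi :=
    Real.mul_self_sqrt (by positivity)
  rw [mul_mul_mul_comm, ← Real.exp_add, ← mul_assoc]
  congr 1
  · rw [← mul_inv, ← mul_inv]; congr 1; linear_combination (-σ1 * σ2 * Real.sqrt (1 - ρ ^ 2)) * e3
  · congr 1
    have := hρ.ne'
    field_simp
    ring

lemma aux_meas (μ1 μ2 σ1 σ2 ρ : ℝ) : Measurable (biGaussPDF μ1 μ2 σ1 σ2 ρ) := by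
  unfold biGaussPDF biStdGaussPDF; fun_prop

lemma aux_marg {Ω : Type*} [MeasurableSpace Ω] (P : Measure Ω)
    (Z1 Z2 : Ω → ℝ) (hZ1 : Measurable Z1) (hZ2 : Measurable Z2)
    (μ1 μ2 σ1 σ2 ρ : ℝ) (hσ1 : 0 < σ1) (hσ2 : 0 < σ2) (hρ : 0 < 1 - ρ ^ 2)
    (hjoint : IsBiGaussian P Z1 Z2 μ1 μ2 σ1 σ2 ρ) :
    Measure.map Z2 P = gaussianReal μ2 (Real.toNNReal (σ2 ^ 2)) := by
  have hs2 : Real.toNNReal (σ2 ^ 2) ≠ 0 := by simp; positivity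
  have hs1 : Real.toNNReal (σ1 ^ 2 * (1 - ρ ^ 2)) ≠ 0 := by
    simp only [ne_eq, Real.toNNReal_eq_zero, not_le]; positivity
  ext A hA
  have : Measure.map Z2 P = Measure.map Prod.snd (Measure.map (fun ω => (Z1 ω, Z2 ω)) P) := by
    rw [Measure.map_map (by fun_prop) (by fun_prop)]; rfl
  rw [this, hjoint, Measure.map_apply measurable_snd hA,
    withDensity_apply _ (measurable_snd hA), gaussianReal_apply _ hs2,
    ← lintegral_indicator (measurable_snd hA), Measure.volume_eq_prod, lintegral_prod_symm,
    ← lintegral_indicator hA]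
  · congr 1
    ext y
    by_cases hy : y ∈ A
    · simp only [Set.indicator, Set.mem_preimage, hy, if_true]
      simp_rw [aux_factor μ1 μ2 σ1 σ2 ρ hσ1 hσ2 hρ,
        ENNReal.ofReal_mul (gaussianPDFReal_nonneg _ _ _)]
      rw [lintegral_const_mul' _ _ ENNReal.ofReal_ne_top, lintegral_gaussianPDFReal_eq_one _ hs1,
        mul_one]
      rfl
    · simp [Set.indicator, hy]
  · exact (((aux_meas μ1 μ2 σ1 σ2 ρ).ennreal_ofReal).indicator (measurable_snd hA)).aemeasurable

lemma aux_cdf {Ω : Type*} [MeasurableSpace Ω] (P : Measure Ω)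
    (Z2 : Ω → ℝ) (hZ2 : Measurable Z2) (μ2 σ2 : ℝ) (hσ2 : 0 < σ2)
    (h : Measure.map Z2 P = gaussianReal μ2 (Real.toNNReal (σ2 ^ 2))) (x : ℝ) :
    (P {ω | Z2 ω ≤ x}).toReal = stdNormalCDF ((x - μ2) / σ2) := by
  have e : gaussianReal μ2 (Real.toNNReal (σ2 ^ 2))
      = Measure.map (fun x => μ2 + σ2 * x) (gaussianReal 0 1) := by
    have : (fun x : ℝ => μ2 + σ2 * x) = (fun x => μ2 + x) ∘ (fun x => σ2 * x) := rfl
    rw [this, ← Measure.map_map (by fun_prop) (by fun_prop), gaussianReal_map_const_mul,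
      gaussianReal_map_const_add]
    congr 1
    · simp
    · ext; simp [sq_nonneg]
  have : P {ω | Z2 ω ≤ x} = Measure.map Z2 P (Set.Iic x) := by
    rw [Measure.map_apply hZ2 measurableSet_Iic]; rfl
  rw [this, h, e, Measure.map_apply (by fun_prop) measurableSet_Iic, stdNormalCDF]
  congr 2
  ext t
  simp only [Set.mem_preimage, Set.mem_Iic]
  rw [le_div_iff₀ hσ2]
  constructor <;> intro h <;> linarith

lemma aux_Phi_strictMono : StrictMono stdNormalCDF := by
  intro a b hab
  unfold stdNormalCDF
  have : (gaussianReal 0 1) (Set.Iic b) = gaussianReal 0 1 (Set.Iic a) + gaussianReal 0 1 (Set.Ioc a b) := by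
    rw [← measure_union (Set.Iic_disjoint_Ioc le_rfl) measurableSet_Ioc, Set.Iic_union_Ioc_eq_Iic hab.le]
  rw [this, ENNReal.toReal_add (measure_ne_top _ _) (measure_ne_top _ _)]
  have h : gaussianReal 0 1 (Set.Ioc a b) ≠ 0 := by
    intro h0
    have := gaussianReal_absolutelyContinuous' 0 (v := 1) one_ne_zero h0
    simp at this
    linarith
  have := ENNReal.toReal_pos h (measure_ne_top _ _)
  linarith

lemma aux_one_sub (u : ℝ) : 1 - stdNormalCDF u = ∫ x in Set.Ioi u, stdNormalPDF x := by
  have h1 : 1 - stdNormalCDF u = (gaussianReal 0 1).real (Set.Ioi u) := by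
    have := prob_compl_eq_one_sub (μ := gaussianReal 0 1) (measurableSet_Iic (a := u))
    rw [Set.compl_Iic] at this
    rw [Measure.real, this, ENNReal.toReal_sub_of_le prob_le_one (by simp)]
    simp [stdNormalCDF]
  rw [h1, Measure.real, gaussianReal_apply_eq_integral 0 one_ne_zero, ENNReal.toReal_ofReal]
  · simp [gaussianPDFReal, stdNormalPDF]
  · exact integral_nonneg fun x => gaussianPDFReal_nonneg _ _ _

lemma aux_Phi_cont : Continuous stdNormalCDF := by
  have hi : Integrable stdNormalPDF := by
    have := integrable_gaussianPDFReal 0 1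
    convert this using 1
    ext x; simp [gaussianPDFReal, stdNormalPDF]
  have h0 : ∀ u, stdNormalCDF u = stdNormalCDF 0 + ∫ x in (0:ℝ)..u, stdNormalPDF x := by
    intro u
    have := intervalIntegral.integral_Ioi_sub_Ioi' (a := 0) (b := u) hi.integrableOn hi.integrableOn
    rw [← this, ← aux_one_sub, ← aux_one_sub]; ring
  rw [show stdNormalCDF = _ from funext h0]
  exact continuous_const.add (intervalIntegral.continuous_primitive (fun a b => hi.intervalIntegrable) 0)

lemma aux_Phi_top : Tendsto stdNormalCDF atTop (𝓝 1) := by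
  have : stdNormalCDF = cdf (gaussianReal 0 1) := by ext x; rw [cdf_eq_real]; rfl
  rw [this]; exact tendsto_cdf_atTop _

lemma aux_Phi_bot : Tendsto stdNormalCDF atBot (𝓝 0) := by
  have : stdNormalCDF = cdf (gaussianReal 0 1) := by ext x; rw [cdf_eq_real]; rfl
  rw [this]; exact tendsto_cdf_atBot _

lemma aux_quant {p : ℝ} (hp : p ∈ Set.Ioo (0:ℝ) 1) : stdNormalCDF (stdNormalQuantile p) = p := by
  obtain ⟨u, hu⟩ : ∃ u, stdNormalCDF u = p :=
    mem_range_of_exists_le_of_exists_ge aux_Phi_cont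
      ((aux_Phi_bot.eventually (eventually_le_nhds hp.1)).exists)
      ((aux_Phi_top.eventually (eventually_ge_nhds hp.2)).exists)
  have : {x : ℝ | p ≤ stdNormalCDF x} = Set.Ici u := by
    ext x; simp only [Set.mem_ofPred_eq, Set.mem_Ici, ← hu]; exact aux_Phi_strictMono.le_iff_le
  rw [stdNormalQuantile, this, csInf_Ici, hu]

lemma aux_quant_top : Tendsto stdNormalQuantile (𝓝[<] (1:ℝ)) atTop := by
  rw [tendsto_atTop]
  intro M
  have hM : stdNormalCDF M < 1 := by
    refine lt_of_lt_of_le (aux_Phi_strictMono (lt_add_one M)) ?_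
    exact ENNReal.toReal_le_of_le_ofReal zero_le_one (by simpa using prob_le_one)
  have hM0 : 0 ≤ stdNormalCDF M := ENNReal.toReal_nonneg
  filter_upwards [Ioo_mem_nhdsLT hM] with p hp
  have := aux_quant (p := p) ⟨lt_of_le_of_lt hM0 hp.1, hp.2⟩
  rw [← aux_Phi_strictMono.le_iff_le, this]
  exact hp.1.le

lemma aux_VaR {Ω : Type*} [MeasurableSpace Ω] (P : Measure Ω)
    (Z2 : Ω → ℝ) (μ2 σ2 : ℝ) (hσ2 : 0 < σ2)
    (h : ∀ x, (P {ω | Z2 ω ≤ x}).toReal = stdNormalCDF ((x - μ2) / σ2)) {p : ℝ}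
    (hp : p ∈ Set.Ioo (0:ℝ) 1) : VaR P Z2 p = μ2 + σ2 * stdNormalQuantile p := by
  have : {x : ℝ | p ≤ (P {ω | Z2 ω ≤ x}).toReal} = Set.Ici (μ2 + σ2 * stdNormalQuantile p) := by
    ext x
    simp only [Set.mem_ofPred_eq, Set.mem_Ici, h]
    nth_rewrite 1 [← aux_quant hp]
    rw [aux_Phi_strictMono.le_iff_le, le_div_iff₀ hσ2]
    constructor <;> intro h <;> linarith
  rw [VaR, this, csInf_Ici]

lemma aux_Q_nonneg {ρ : ℝ} (hρ : 0 < 1 - ρ ^ 2) (s t : ℝ) :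
    0 ≤ (s ^ 2 - 2 * ρ * s * t + t ^ 2) / (2 * (1 - ρ ^ 2)) := by
  apply div_nonneg _ (by positivity)
  nlinarith [sq_nonneg (s - ρ * t), mul_nonneg hρ.le (sq_nonneg t)]

/-- the rescaled integral -/
def auxI (ρ A B u : ℝ) : ℝ :=
  ∫ z in (Set.Ioi (0:ℝ)) ×ˢ (Set.Ioi (0:ℝ)), z.1 * Real.exp (-(A * z.1 + B * z.2)
    - (z.1 ^ 2 - 2 * ρ * z.1 * z.2 + z.2 ^ 2) / (2 * (1 - ρ ^ 2)) / u ^ 2)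

lemma aux_num {Ω : Type*} [MeasurableSpace Ω] (P : Measure Ω)
    (Z1 Z2 : Ω → ℝ) (hZ1 : Measurable Z1) (hZ2 : Measurable Z2)
    (μ1 μ2 σ1 σ2 ρ : ℝ) (hσ1 : 0 < σ1) (hσ2 : 0 < σ2) (hρ : 0 < 1 - ρ ^ 2)
    (hjoint : IsBiGaussian P Z1 Z2 μ1 μ2 σ1 σ2 ρ) (u v a : ℝ) (hu : 0 < u)
    (hv : v = μ2 + σ2 * u) (ha : a = σ2 * u / σ1 + (μ2 - μ1) / σ1) :
    ∫ ω in {ω | v < Z2 ω}, max (Z1 ω - v) 0 ∂P =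
      σ1 * (u ^ 3)⁻¹ * biStdGaussPDF ρ a u *
        auxI ρ ((a - ρ * u) / (1 - ρ ^ 2) / u) ((u - ρ * a) / (1 - ρ ^ 2) / u) u := by
  have hS : MeasurableSet {z : ℝ × ℝ | v < z.2} := measurableSet_lt measurable_const measurable_snd
  set G : ℝ × ℝ → ℝ := Set.indicator {z : ℝ × ℝ | v < z.2} (fun z => max (z.1 - v) 0) with hG
  have hGm : Measurable G := Measurable.indicator (by fun_prop) hS
  have s1 : ∫ ω in {ω | v < Z2 ω}, max (Z1 ω - v) 0 ∂P = ∫ ω, G (Z1 ω, Z2 ω) ∂P := by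
    rw [← integral_indicator (measurableSet_lt measurable_const hZ2)]
    rfl
  have s2 : ∫ ω, G (Z1 ω, Z2 ω) ∂P = ∫ z, G z ∂(Measure.map (fun ω => (Z1 ω, Z2 ω)) P) :=
    (integral_map (by fun_prop) hGm.aestronglyMeasurable).symm
  have hpos : ∀ z, 0 ≤ biGaussPDF μ1 μ2 σ1 σ2 ρ z := by
    intro z; unfold biGaussPDF biStdGaussPDF; positivity
  rw [s1, s2, hjoint, integral_withDensity_eq_integral_toReal_smul
    (aux_meas μ1 μ2 σ1 σ2 ρ).ennreal_ofReal (by simp)]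
  simp_rw [ENNReal.toReal_ofReal (hpos _), smul_eq_mul]
  rw [aux_chg v v (c1 := σ1 / u) (c2 := σ2 / u) (by positivity) (by positivity) _
    (show Measurable (fun z => biGaussPDF μ1 μ2 σ1 σ2 ρ z * G z) from
      (aux_meas μ1 μ2 σ1 σ2 ρ).mul hGm), auxI,
    ← integral_indicator (measurableSet_Ioi.prod measurableSet_Ioi), ← integral_const_mul,
    ← integral_const_mul]
  congr 1
  ext ⟨s, t⟩
  simp only [hG, Set.indicator, Set.mem_ofPred_eq, Set.mem_prod, Set.mem_Ioi]
  have e1 : v < v + σ2 / u * t ↔ 0 < t := by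
    rw [lt_add_iff_pos_right, mul_pos_iff_of_pos_left (by positivity)]
  by_cases ht : 0 < t
  · by_cases hs : 0 < s
    · rw [if_pos (e1.2 ht), if_pos ⟨hs, ht⟩, max_eq_left (by rw [add_sub_cancel_left]; positivity)]
      unfold biGaussPDF biStdGaussPDF
      have e2 : (v + σ1 / u * s - μ1) / σ1 = a + s / u := by rw [hv, ha]; field_simp; ring
      have e3 : (v + σ2 / u * t - μ2) / σ2 = u + t / u := by rw [hv]; field_simp; ring
      simp only [e2, e3]
      have e4 : -((a + s / u) ^ 2 - 2 * ρ * (a + s / u) * (u + t / u) + (u + t / u) ^ 2) / (2 * (1 - ρ ^ 2))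
        = -(a ^ 2 - 2 * ρ * a * u + u ^ 2) / (2 * (1 - ρ ^ 2)) +
          (-((a - ρ * u) / (1 - ρ ^ 2) / u * s + (u - ρ * a) / (1 - ρ ^ 2) / u * t)
            - (s ^ 2 - 2 * ρ * s * t + t ^ 2) / (2 * (1 - ρ ^ 2)) / u ^ 2) := by
        have := hρ.ne'
        field_simp
        ring
      rw [e4, Real.exp_add]
      field_simp
      ring
    · rw [if_pos (e1.2 ht), if_neg (fun h : 0 < s ∧ 0 < t => hs h.1), max_eq_right]
      · simp
      · have : σ1 / u * s ≤ 0 := mul_nonpos_of_nonneg_of_nonpos (by positivity) (not_lt.1 hs)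
        linarith
  · rw [if_neg (mt e1.1 ht), if_neg (fun h : 0 < s ∧ 0 < t => ht h.2)]; simp

lemma aux_int1 {r : ℝ} (hr : 0 < r) :
    IntegrableOn (fun x : ℝ => x * Real.exp (-r * x)) (Set.Ioi 0) := by
  have := integrableOn_rpow_mul_exp_neg_mul_rpow (p := 1) (s := 1) (b := r) (by norm_num) (by norm_num) hr
  simpa using this

lemma aux_int0 {r : ℝ} (hr : 0 < r) :
    IntegrableOn (fun x : ℝ => Real.exp (-r * x)) (Set.Ioi 0) :=
  integrableOn_exp_mul_Ioi (by linarith) 0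

lemma aux_val1 {r : ℝ} (hr : 0 < r) :
    ∫ x in Set.Ioi (0:ℝ), x * Real.exp (-r * x) = (r ^ 2)⁻¹ := by
  have := Real.integral_rpow_mul_exp_neg_mul_Ioi (a := 2) (r := r) (by norm_num) hr
  norm_num at this
  simpa using this

lemma aux_val0 {r : ℝ} (hr : 0 < r) :
    ∫ x in Set.Ioi (0:ℝ), Real.exp (-r * x) = r⁻¹ := by
  rw [integral_exp_mul_Ioi (by linarith)]
  simp

lemma aux_lap {ρ : ℝ} (hρ : 0 < 1 - ρ ^ 2) {h1 h2 : ℝ} (hh1 : 0 < h1) (hh2 : 0 < h2)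
    (A B : ℝ → ℝ) (hA : Tendsto A atTop (𝓝 h1)) (hB : Tendsto B atTop (𝓝 h2)) :
    Tendsto (fun u => auxI ρ (A u) (B u) u) atTop (𝓝 ((h1 ^ 2)⁻¹ * h2⁻¹)) := by
  have lim : (h1 ^ 2)⁻¹ * h2⁻¹ = ∫ z in (Set.Ioi (0:ℝ)) ×ˢ (Set.Ioi (0:ℝ)),
      (z.1 * Real.exp (-h1 * z.1)) * Real.exp (-h2 * z.2) := by
    rw [Measure.volume_eq_prod, setIntegral_prod_mul (fun x => x * Real.exp (-h1 * x))
      (fun x => Real.exp (-h2 * x)), aux_val1 hh1, aux_val0 hh2]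
  rw [lim]
  unfold auxI
  refine tendsto_integral_filter_of_dominated_convergence
    (fun z => (z.1 * Real.exp (-(h1/2) * z.1)) * Real.exp (-(h2/2) * z.2)) ?_ ?_ ?_ ?_
  · refine Eventually.of_forall fun u => Measurable.aestronglyMeasurable (by fun_prop)
  · filter_upwards [hA.eventually (eventually_ge_nhds (half_lt_self hh1)),
      hB.eventually (eventually_ge_nhds (half_lt_self hh2))] with u hAu hBu
    refine (ae_restrict_mem (measurableSet_Ioi.prod measurableSet_Ioi)).mono ?_
    rintro ⟨s, t⟩ ⟨hs, ht⟩
    simp only [Set.mem_Ioi] at hs ht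
    rw [Real.norm_of_nonneg (by positivity), mul_assoc _ (Real.exp _) (Real.exp _), ← Real.exp_add]
    dsimp only
    gcongr
    have := div_nonneg (aux_Q_nonneg hρ s t) (sq_nonneg u)
    nlinarith [mul_le_mul_of_nonneg_right hAu hs.le, mul_le_mul_of_nonneg_right hBu ht.le]
  · rw [Measure.volume_eq_prod, ← Measure.prod_restrict]
    exact (aux_int1 (half_pos hh1)).mul_prod (aux_int0 (half_pos hh2))
  · refine Eventually.of_forall fun z => ?_
    rw [mul_assoc _ (Real.exp _) (Real.exp _), ← Real.exp_add]
    refine Tendsto.const_mul _ ((Real.continuous_exp.tendsto _).comp ?_)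
    have e : -h1 * z.1 + -h2 * z.2 = -(h1 * z.1 + h2 * z.2) - 0 := by ring
    rw [e]
    refine (((hA.mul_const _).add (hB.mul_const _)).neg).sub ?_
    exact Tendsto.const_div_atTop (tendsto_pow_atTop two_ne_zero) _

lemma aux_mills : Tendsto (fun u => u * Real.sqrt (2 * Real.pi) * Real.exp (u ^ 2 / 2) *
    (1 - stdNormalCDF u)) atTop (𝓝 1) := by
  have key : ∀ᶠ u : ℝ in atTop, ∫ x in Set.Ioi (0:ℝ), Real.exp (-1 * x - x ^ 2 / 2 / u ^ 2)
      = u * Real.sqrt (2 * Real.pi) * Real.exp (u ^ 2 / 2) * (1 - stdNormalCDF u) := by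
    filter_upwards [eventually_gt_atTop 0] with u hu
    rw [aux_one_sub]
    have t1 := integral_comp_mul_left_Ioi (fun x => stdNormalPDF (x + u)) 0 (b := u⁻¹) (by positivity)
    have t2 : ∫ x in Set.Ioi (0:ℝ), stdNormalPDF (x + u) = ∫ x in Set.Ioi u, stdNormalPDF x := by
      have := (measurePreserving_add_right volume u).setIntegral_preimage_emb
        (measurableEmbedding_addRight u) stdNormalPDF (Set.Ioi u)
      simpa using this
    rw [mul_zero, t2, inv_inv, smul_eq_mul] at t1
    have t3 : u * Real.sqrt (2 * Real.pi) * Real.exp (u ^ 2 / 2) * ∫ x in Set.Ioi u, stdNormalPDF x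
       = (Real.sqrt (2 * Real.pi) * Real.exp (u ^ 2 / 2)) * (u * ∫ x in Set.Ioi u, stdNormalPDF x) := by
      ring
    rw [t3, ← t1, ← integral_const_mul]
    congr 1
    ext x
    unfold stdNormalPDF
    have hp : Real.sqrt (2 * Real.pi) ≠ 0 := by positivity
    have : -1 * x - x ^ 2 / 2 / u ^ 2 = u ^ 2 / 2 + -(u⁻¹ * x + u) ^ 2 / 2 := by
      field_simp; ring
    rw [this, Real.exp_add]
    field_simp
  refine Tendsto.congr' key ?_
  have lim : (1:ℝ) = ∫ x in Set.Ioi (0:ℝ), Real.exp (-1 * x) := by rw [aux_val0 one_pos]; simp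
  refine Eq.subst (motive := fun y => Tendsto _ _ (𝓝 y)) lim.symm ?_
  refine tendsto_integral_filter_of_dominated_convergence (fun x => Real.exp (-1 * x)) ?_ ?_
    (aux_int0 one_pos) ?_
  · refine Eventually.of_forall fun u => Measurable.aestronglyMeasurable (by fun_prop)
  · refine Eventually.of_forall fun u => Eventually.of_forall fun x => ?_
    rw [Real.norm_of_nonneg (by positivity)]
    gcongr
    have : 0 ≤ x ^ 2 / 2 / u ^ 2 := by positivity
    linarith
  · refine Eventually.of_forall fun z => ?_
    refine (Real.continuous_exp.tendsto _).comp ?_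
    nth_rewrite 2 [← sub_zero (-1 * z)]
    refine tendsto_const_nhds.sub ?_
    exact Tendsto.const_div_atTop (tendsto_pow_atTop two_ne_zero) _

/-- Theorem 1.1 i): if `σ₂ > ρσ₁` and `σ₁ > ρσ₂`, then as `p ↑ 1`,
`E(p) ~ (σ₁/(h₁²h₂)) √(2π) u_p⁻² e^{u_p²/2} φ_ρ(σ₂u_p/σ₁ + β, u_p)`, where
`h₁ = (σ₂-ρσ₁)/(σ₁(1-ρ²)) > 0`, `h₂ = (σ₁-ρσ₂)/(σ₁(1-ρ²)) > 0`;
in particular `E(p) → 0`. -/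
theorem mme_bivariate_gaussian_case_i
    {Ω : Type*} [MeasurableSpace Ω] (P : Measure Ω) [IsProbabilityMeasure P]
    (Z1 Z2 : Ω → ℝ) (hZ1 : Measurable Z1) (hZ2 : Measurable Z2)
    (μ1 μ2 σ1 σ2 ρ : ℝ) (hσ1 : 0 < σ1) (hσ2 : 0 < σ2) (hρ1 : -1 < ρ) (hρ2 : ρ < 1)
    (hjoint : IsBiGaussian P Z1 Z2 μ1 μ2 σ1 σ2 ρ)
    (hcase1 : ρ * σ1 < σ2) (hcase2 : ρ * σ2 < σ1) :
    0 < (σ2 - ρ * σ1) / (σ1 * (1 - ρ ^ 2)) ∧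
    0 < (σ1 - ρ * σ2) / (σ1 * (1 - ρ ^ 2)) ∧
    Tendsto (fun p => mme2 P Z1 Z2 p /
        (σ1 / (((σ2 - ρ * σ1) / (σ1 * (1 - ρ ^ 2))) ^ 2 *
              ((σ1 - ρ * σ2) / (σ1 * (1 - ρ ^ 2)))) *
          Real.sqrt (2 * Real.pi) * ((stdNormalQuantile p) ^ 2)⁻¹ *
          Real.exp ((stdNormalQuantile p) ^ 2 / 2) *
          biStdGaussPDF ρ (σ2 * stdNormalQuantile p / σ1 + (μ2 - μ1) / σ1)
            (stdNormalQuantile p)))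
      (𝓝[<] (1 : ℝ)) (𝓝 1) ∧
    Tendsto (fun p => mme2 P Z1 Z2 p) (𝓝[<] (1 : ℝ)) (𝓝 0) := by
  have hρ : 0 < 1 - ρ ^ 2 := by nlinarith
  have hh1 : 0 < (σ2 - ρ * σ1) / (σ1 * (1 - ρ ^ 2)) := div_pos (by linarith) (by positivity)
  have hh2 : 0 < (σ1 - ρ * σ2) / (σ1 * (1 - ρ ^ 2)) := div_pos (by linarith) (by positivity)
  set h1 := (σ2 - ρ * σ1) / (σ1 * (1 - ρ ^ 2)) with hdef1
  set h2 := (σ1 - ρ * σ2) / (σ1 * (1 - ρ ^ 2)) with hdef2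
  have hcdf := aux_cdf P Z2 hZ2 μ2 σ2 hσ2
    (aux_marg P Z1 Z2 hZ1 hZ2 μ1 μ2 σ1 σ2 ρ hσ1 hσ2 hρ hjoint)
  set β := (μ2 - μ1) / σ1 with hβ
  let a : ℝ → ℝ := fun u => σ2 * u / σ1 + β
  let I : ℝ → ℝ := fun u => auxI ρ ((a u - ρ * u) / (1 - ρ ^ 2) / u) ((u - ρ * a u) / (1 - ρ ^ 2) / u) u
  have hinv : Tendsto (fun u : ℝ => u⁻¹) atTop (𝓝 0) := tendsto_inv_atTop_zero
  have hI : Tendsto I atTop (𝓝 ((h1 ^ 2)⁻¹ * h2⁻¹)) := by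
    refine aux_lap hρ hh1 hh2 _ _ ?_ ?_
    · have : Tendsto (fun u : ℝ => h1 + β / (1 - ρ ^ 2) * u⁻¹) atTop (𝓝 (h1 + β / (1 - ρ ^ 2) * 0)) :=
        tendsto_const_nhds.add (hinv.const_mul _)
      rw [mul_zero, add_zero] at this
      refine this.congr' ?_
      filter_upwards [eventually_gt_atTop 0] with u hu
      simp only [a, hdef1]
      have := hρ.ne'
      field_simp
      ring
    · have : Tendsto (fun u : ℝ => h2 - ρ * β / (1 - ρ ^ 2) * u⁻¹) atTop (𝓝 (h2 - ρ * β / (1 - ρ ^ 2) * 0)) :=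
        tendsto_const_nhds.sub (hinv.const_mul _)
      rw [mul_zero, sub_zero] at this
      refine this.congr' ?_
      filter_upwards [eventually_gt_atTop 0] with u hu
      simp only [a, hdef2]
      have := hρ.ne'
      field_simp
      ring
  have hmme : ∀ᶠ p in 𝓝[<] (1:ℝ), mme2 P Z1 Z2 p =
      (σ1 * ((stdNormalQuantile p) ^ 3)⁻¹ * biStdGaussPDF ρ (a (stdNormalQuantile p)) (stdNormalQuantile p)
        * I (stdNormalQuantile p)) / (1 - stdNormalCDF (stdNormalQuantile p)) := by
    filter_upwards [Ioo_mem_nhdsLT (zero_lt_one' ℝ), aux_quant_top.eventually (eventually_gt_atTop 0)]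
      with p hp hu
    have hV := aux_VaR P Z2 μ2 σ2 hσ2 hcdf hp
    unfold mme2
    rw [aux_num P Z1 Z2 hZ1 hZ2 μ1 μ2 σ1 σ2 ρ hσ1 hσ2 hρ hjoint _ _ (a (stdNormalQuantile p)) hu hV rfl]
    congr 1
    have hc := hcdf (VaR P Z2 p)
    have : {ω | VaR P Z2 p < Z2 ω} = {ω | Z2 ω ≤ VaR P Z2 p}ᶜ := by ext; simp
    rw [this, prob_compl_eq_one_sub (measurableSet_le hZ2 measurable_const),
      ENNReal.toReal_sub_of_le prob_le_one (by simp), hc, hV]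
    simp [hσ2.ne']
  let D : ℝ → ℝ := fun u => σ1 / (h1 ^ 2 * h2) * Real.sqrt (2 * Real.pi) * (u ^ 2)⁻¹ *
          Real.exp (u ^ 2 / 2) * biStdGaussPDF ρ (a u) u
  have hratio : Tendsto (fun p => mme2 P Z1 Z2 p / D (stdNormalQuantile p)) (𝓝[<] (1 : ℝ)) (𝓝 1) := by
    have hlim : Tendsto (fun u => I u * (h1 ^ 2 * h2) / (u * Real.sqrt (2 * Real.pi) *
        Real.exp (u ^ 2 / 2) * (1 - stdNormalCDF u))) atTop (𝓝 1) := by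
      have := (hI.mul_const (h1 ^ 2 * h2)).div aux_mills one_ne_zero
      have e : (h1 ^ 2)⁻¹ * h2⁻¹ * (h1 ^ 2 * h2) / 1 = 1 := by field_simp
      rwa [e] at this
    refine (hlim.comp aux_quant_top).congr' ?_
    filter_upwards [hmme, aux_quant_top.eventually (eventually_gt_atTop 0)] with p hp hu
    rw [hp]
    simp only [Function.comp, D]
    generalize stdNormalQuantile p = u at hu ⊢
    have hb : biStdGaussPDF ρ (a u) u ≠ 0 := by
      unfold biStdGaussPDF; positivity
    have hs : Real.sqrt (2 * Real.pi) ≠ 0 := by positivity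
    field_simp
  have hDlim : Tendsto D atTop (𝓝 0) := by
    have hb : Tendsto (fun u : ℝ => σ1 / (h1 ^ 2 * h2) * Real.sqrt (2 * Real.pi) *
        (2 * Real.pi * Real.sqrt (1 - ρ ^ 2))⁻¹ * (u ^ 2)⁻¹) atTop (𝓝 0) := by
      rw [← mul_zero (σ1 / (h1 ^ 2 * h2) * Real.sqrt (2 * Real.pi) *
        (2 * Real.pi * Real.sqrt (1 - ρ ^ 2))⁻¹)]
      exact (tendsto_inv_atTop_zero.comp (tendsto_pow_atTop two_ne_zero)).const_mul _
    refine squeeze_zero (fun u => ?_) (fun u => ?_) hb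
    · simp only [D, biStdGaussPDF]; positivity
    · simp only [D, biStdGaussPDF]
      have e : Real.exp (u ^ 2 / 2) * Real.exp (-((a u) ^ 2 - 2 * ρ * (a u) * u + u ^ 2) / (2 * (1 - ρ ^ 2))) ≤ 1 := by
        rw [← Real.exp_add, Real.exp_le_one_iff]
        have : u ^ 2 / 2 + -((a u) ^ 2 - 2 * ρ * (a u) * u + u ^ 2) / (2 * (1 - ρ ^ 2))
          = - ((a u - ρ * u) ^ 2 / (2 * (1 - ρ ^ 2))) := by
          have := hρ.ne'
          field_simp
          ring
        rw [this, neg_nonpos]; positivity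
      have hc : 0 ≤ σ1 / (h1 ^ 2 * h2) * Real.sqrt (2 * Real.pi) *
        (2 * Real.pi * Real.sqrt (1 - ρ ^ 2))⁻¹ * (u ^ 2)⁻¹ := by positivity
      have := mul_le_mul_of_nonneg_left e hc
      rw [mul_one] at this
      refine le_trans (le_of_eq ?_) this
      ring
  refine ⟨hh1, hh2, hratio, ?_⟩
  have := hratio.mul (hDlim.comp aux_quant_top)
  rw [one_mul] at this
  refine this.congr' ?_
  filter_upwards [aux_quant_top.eventually (eventually_gt_atTop 0)] with p hu
  have : D (stdNormalQuantile p) ≠ 0 := by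
    simp only [D, biStdGaussPDF]; positivity
  simp only [Function.comp]
  field_simp
end
end

section
/- Let (Z_1,Z_2) be jointly Gaussian with Z_i ~ N(\mu_i,\sigma_i^2) (\sigma_i>0) and correlation \rho \in (-1,1), and set \beta = (\mu_2-\mu_1)/\sigma_1, \eta = \beta/\sqrt{1-\rho^2}. If \sigma_2 = \rho\sigma_1, then the marginal mean excess satisfies lim_{p \uparrow 1} E(p) = \sigma_1 \sqrt{1-\rho^2} ( \varphi(\eta) - \eta [1 - \Phi(\eta)] ), and this limit lies in (0,\infty), where \varphi = \Phi' is the standard normal density. -/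
open MeasureTheory ProbabilityTheory Filter
open scoped Topology ENNReal

noncomputable section

lemma pdf_eq : gaussianPDFReal 0 1 = stdNormalPDF := by
  ext x; simp [gaussianPDFReal, stdNormalPDF]

lemma pdf_hasDeriv (x : ℝ) : HasDerivAt stdNormalPDF (-(x * stdNormalPDF x)) x := by
  unfold stdNormalPDF
  have h : HasDerivAt (fun x : ℝ => -x ^ 2 / 2) (-x) x := by
    have := ((hasDerivAt_pow 2 x).fun_neg).div_const 2
    refine this.congr_deriv ?_
    norm_num
    ring
  have := (h.exp).const_mul (Real.sqrt (2 * Real.pi))⁻¹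
  refine this.congr_deriv ?_
  ring

lemma pdf_int0 : Integrable stdNormalPDF := by
  rw [← pdf_eq]; exact integrable_gaussianPDFReal 0 1

lemma pdf_int1 : Integrable (fun x => x * stdNormalPDF x) := by
  have h := (integrable_mul_exp_neg_mul_sq (b := 1/2) (by norm_num)).const_mul
    (Real.sqrt (2 * Real.pi))⁻¹
  refine h.congr (ae_of_all _ fun x => ?_)
  simp only [stdNormalPDF]
  rw [show -(1/2) * x ^ 2 = -x^2/2 by ring]
  ring

lemma pdf_int2 : Integrable (fun x => x ^ 2 * stdNormalPDF x) := by
  have h := (integrable_rpow_mul_exp_neg_mul_sq (b := 1/2) (by norm_num) (s := 2)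
    (by norm_num)).const_mul (Real.sqrt (2 * Real.pi))⁻¹
  refine h.congr (ae_of_all _ fun x => ?_)
  simp only [stdNormalPDF]
  rw [show -(1/2) * x ^ 2 = -x^2/2 by ring, Real.rpow_two]
  ring

lemma pdf_tendsto1 : Tendsto (fun x => x * stdNormalPDF x) atTop (𝓝 0) := by
  have h := (rpow_mul_exp_neg_mul_sq_isLittleO_exp_neg (b := 1/2) (by norm_num) 1)
  have h2 : Tendsto (fun x : ℝ => Real.exp (-(1/2) * x)) atTop (𝓝 0) := by
    apply Real.tendsto_exp_atBot.comp
    exact tendsto_id.const_mul_atTop_of_neg (by norm_num)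
  have h3 := (h.isBigO.trans_tendsto h2).const_mul (Real.sqrt (2 * Real.pi))⁻¹
  rw [mul_zero] at h3
  refine h3.congr fun x => ?_
  simp only [stdNormalPDF]
  rw [show -(1/2) * x ^ 2 = -x^2/2 by ring, Real.rpow_one]
  ring

lemma pdf_pos (x : ℝ) : 0 < stdNormalPDF x := by
  unfold stdNormalPDF; positivity

lemma pdf_tendsto0 : Tendsto stdNormalPDF atTop (𝓝 0) := by
  refine squeeze_zero' (Eventually.of_forall fun x => (pdf_pos x).le) ?_ pdf_tendsto1
  filter_upwards [eventually_ge_atTop 1] with x hx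
  nlinarith [pdf_pos x]

lemma tail_eq (a : ℝ) : 1 - stdNormalCDF a = ∫ x in Set.Ioi a, stdNormalPDF x := by
  have h : (gaussianReal 0 1).real (Set.Ioi a) = 1 - stdNormalCDF a := by
    rw [← Set.compl_Iic, probReal_compl_eq_one_sub measurableSet_Iic]; rfl
  rw [← h, Measure.real, gaussianReal_apply_eq_integral 0 one_ne_zero, pdf_eq,
    ENNReal.toReal_ofReal]
  exact setIntegral_nonneg measurableSet_Ioi fun x _ => (pdf_pos x).le

lemma tail_pos (a : ℝ) : 0 < 1 - stdNormalCDF a := by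
  rw [tail_eq, setIntegral_pos_iff_support_of_nonneg_ae
    (ae_of_all _ fun x => (pdf_pos x).le) pdf_int0.integrableOn]
  have : Function.support stdNormalPDF = Set.univ := by
    ext x; simp [(pdf_pos x).ne']
  simp [this]

def meanEx (a : ℝ) : ℝ := ∫ x, max (x - a) 0 ∂(gaussianReal 0 1)

lemma meanEx_eq (a : ℝ) : meanEx a = ∫ x in Set.Ioi a, (x - a) * stdNormalPDF x := by
  rw [meanEx, integral_gaussianReal_eq_integral_smul one_ne_zero, pdf_eq,
    ← integral_indicator measurableSet_Ioi]
  refine integral_congr_ae (ae_of_all _ fun x => ?_)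
  by_cases h : a < x
  · simp [Set.indicator, h, h.le, mul_comm]
  · simp [Set.indicator, h, not_lt.mp h]

lemma int1a (a : ℝ) : Integrable (fun x => (x - a) * stdNormalPDF x) := by
  refine (pdf_int1.sub (pdf_int0.const_mul a)).congr (ae_of_all _ fun x => ?_)
  simp; ring

lemma meanEx_formula (a : ℝ) : meanEx a = stdNormalPDF a - a * (1 - stdNormalCDF a) := by
  have h1 : ∫ x in Set.Ioi a, x * stdNormalPDF x = stdNormalPDF a := by
    rw [integral_Ioi_of_hasDerivAt_of_tendsto' (f := fun x => - stdNormalPDF x) (m := 0)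
      _ pdf_int1.integrableOn]
    · simp
    · simpa using pdf_tendsto0.neg
    · intro x _
      simpa using (pdf_hasDeriv x).fun_neg
  rw [meanEx_eq, tail_eq, ← integral_const_mul]
  simp only [sub_mul]
  rw [integral_sub pdf_int1.integrableOn (pdf_int0.const_mul a).integrableOn, h1]

lemma meanEx_bound (a : ℝ) : a * meanEx a ≤ 1 - stdNormalCDF a := by
  have hi : Integrable (fun x => x * (x - a) * stdNormalPDF x) := by
    refine (pdf_int2.sub (pdf_int1.const_mul a)).congr (ae_of_all _ fun x => ?_)
    simp; ring
  have h1 : ∫ x in Set.Ioi a, (x * (x - a) * stdNormalPDF x - stdNormalPDF x) = 0 := by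
    rw [integral_Ioi_of_hasDerivAt_of_tendsto' (f := fun x => - ((x - a) * stdNormalPDF x))
      (m := 0) _ (show IntegrableOn (fun x => x * (x - a) * stdNormalPDF x - stdNormalPDF x) _ from
        (hi.sub pdf_int0).integrableOn)]
    · simp
    · have := (pdf_tendsto1.sub (pdf_tendsto0.const_mul a)).neg
      simp only [mul_zero, sub_zero, neg_zero] at this
      refine this.congr fun x => by ring
    · intro x _
      have := (((hasDerivAt_id x).sub_const a).fun_mul (pdf_hasDeriv x)).fun_neg
      refine this.congr_deriv ?_
      simp only [id]; ring
  rw [integral_sub hi.integrableOn pdf_int0.integrableOn, ← tail_eq] at h1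
  rw [meanEx_eq, ← integral_const_mul]
  have : ∫ x in Set.Ioi a, a * ((x - a) * stdNormalPDF x) ≤
      ∫ x in Set.Ioi a, x * (x - a) * stdNormalPDF x := by
    refine setIntegral_mono_on ((int1a a).const_mul a).integrableOn hi.integrableOn
      measurableSet_Ioi fun x hx => ?_
    have hx : a < x := hx
    have : 0 ≤ (x - a) * (x - a) * stdNormalPDF x :=
      mul_nonneg (mul_self_nonneg _) (pdf_pos x).le
    nlinarith
  linarith

lemma meanEx_pos (a : ℝ) : 0 < meanEx a := by
  rw [meanEx_eq, setIntegral_pos_iff_support_of_nonneg_ae _ (int1a a).integrableOn]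
  · have : Set.Ioi a ⊆ Function.support (fun x => (x - a) * stdNormalPDF x) := by
      intro x hx
      have hx : a < x := hx
      exact (mul_pos (by linarith) (pdf_pos x)).ne'
    rw [Set.inter_eq_right.2 this]
    simp
  · refine (ae_restrict_iff' measurableSet_Ioi).2 (ae_of_all _ fun x hx => ?_)
    have hx : a < x := hx
    exact (mul_pos (by linarith) (pdf_pos x)).le

lemma dens_eq (μ1 μ2 σ1 σ2 ρ : ℝ) (V1 V2 : NNReal) (hσ1 : 0 < σ1) (hσ2 : 0 < σ2) (hρ1 : -1 < ρ)
    (hρ2 : ρ < 1) (hcase : σ2 = ρ * σ1) (hV1 : (V1 : ℝ) = (σ1 * Real.sqrt (1 - ρ ^ 2)) ^ 2)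
    (hV2 : (V2 : ℝ) = σ2 ^ 2) (d z : ℝ) :
    biGaussPDF μ1 μ2 σ1 σ2 ρ (d + z, z) =
      gaussianPDFReal (μ1 - μ2) V1 d * gaussianPDFReal μ2 V2 z := by
  have hr : 0 < 1 - ρ ^ 2 := by nlinarith
  have ht := Real.sqrt_pos.2 hr
  have ht2 := Real.sq_sqrt hr.le
  simp only [biGaussPDF, biStdGaussPDF, gaussianPDFReal, hV1, hV2]
  set t := Real.sqrt (1 - ρ ^ 2)
  rw [Real.sqrt_mul (x := 2 * Real.pi) (by positivity) ((σ1 * t) ^ 2),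
    Real.sqrt_mul (x := 2 * Real.pi) (by positivity) (σ2 ^ 2),
    Real.sqrt_sq (by positivity), Real.sqrt_sq (by positivity)]
  have hp : Real.sqrt (2 * Real.pi) * Real.sqrt (2 * Real.pi) = 2 * Real.pi :=
    Real.mul_self_sqrt (by positivity)
  rw [mul_mul_mul_comm, ← Real.exp_add, ← mul_assoc, ← mul_inv, ← mul_inv]
  congr 1
  · congr 1
    linear_combination (-(σ1*t*σ2)) * hp
  · congr 1
    have hρ : ρ ≠ 0 := by rintro rfl; simp at hcase; linarith
    rw [mul_pow, ht2, hcase]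
    field_simp
    ring

lemma law_eq {Ω : Type*} [MeasurableSpace Ω] (P : Measure Ω)
    (Z1 Z2 : Ω → ℝ) (hZ1 : Measurable Z1) (hZ2 : Measurable Z2)
    (μ1 μ2 σ1 σ2 ρ : ℝ) (V1 V2 : NNReal) (hσ1 : 0 < σ1) (hσ2 : 0 < σ2) (hρ1 : -1 < ρ)
    (hρ2 : ρ < 1)
    (hjoint : IsBiGaussian P Z1 Z2 μ1 μ2 σ1 σ2 ρ)
    (hcase : σ2 = ρ * σ1) (hV1 : (V1 : ℝ) = (σ1 * Real.sqrt (1 - ρ ^ 2)) ^ 2)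
    (hV2 : (V2 : ℝ) = σ2 ^ 2) (h1 : V1 ≠ 0) (h2 : V2 ≠ 0) :
    Measure.map (fun ω => (Z1 ω - Z2 ω, Z2 ω)) P =
      (gaussianReal (μ1 - μ2) V1).prod (gaussianReal μ2 V2) := by
  have hT := measurePreserving_sub_prod (volume : Measure ℝ) (volume : Measure ℝ)
  have e1 : Measure.map (fun ω => (Z1 ω - Z2 ω, Z2 ω)) P =
      Measure.map (fun z : ℝ × ℝ => (z.1 - z.2, z.2))
        (Measure.map (fun ω => (Z1 ω, Z2 ω)) P) := by
    rw [Measure.map_map (by fun_prop) (by fun_prop)]; rfl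
  rw [e1, hjoint, gaussianReal_of_var_ne_zero _ h1, gaussianReal_of_var_ne_zero _ h2,
    prod_withDensity (measurable_gaussianPDF _ _) (measurable_gaussianPDF _ _)]
  have hm : Measurable fun z : ℝ × ℝ =>
      gaussianPDF (μ1 - μ2) V1 z.1 * gaussianPDF μ2 V2 z.2 :=
    ((measurable_gaussianPDF _ _).comp measurable_fst).mul
      ((measurable_gaussianPDF _ _).comp measurable_snd)
  ext s hs
  rw [Measure.map_apply hT.measurable hs, withDensity_apply _ (hT.measurable hs),
    withDensity_apply _ hs, ← hT.setLIntegral_comp_preimage hs hm, Measure.volume_eq_prod]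
  refine lintegral_congr fun z => ?_
  have := dens_eq μ1 μ2 σ1 σ2 ρ V1 V2 hσ1 hσ2 hρ1 hρ2 hcase hV1 hV2 (z.1 - z.2) z.2
  rw [sub_add_cancel] at this
  rw [this, ENNReal.ofReal_mul (gaussianPDFReal_nonneg _ _ _)]
  rfl

lemma gauss_std (m s : ℝ) (V : NNReal) (hV : (V : ℝ) = s ^ 2) :
    gaussianReal m V = Measure.map (fun x => m + s * x) (gaussianReal 0 1) := by
  have : (fun x : ℝ => m + s * x) = (fun x => m + x) ∘ (fun x => s * x) := rfl
  rw [this, ← Measure.map_map (by fun_prop) (by fun_prop), gaussianReal_map_const_mul,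
    gaussianReal_map_const_add]
  congr 1
  · simp
  · ext; simp [hV]

lemma gauss_tail (m s v : ℝ) (hs : 0 < s) (V : NNReal) (hV : (V : ℝ) = s ^ 2) :
    (gaussianReal m V).real (Set.Ioi v) = 1 - stdNormalCDF ((v - m) / s) := by
  rw [gauss_std m s V hV, map_measureReal_apply (by fun_prop) measurableSet_Ioi]
  have : (fun x => m + s * x) ⁻¹' (Set.Ioi v) = (Set.Iic ((v - m) / s))ᶜ := by
    ext x
    simp [div_lt_iff₀ hs]
    constructor <;> intro h <;> linarith
  rw [this, probReal_compl_eq_one_sub measurableSet_Iic]; rfl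

lemma gauss_excess (m s v : ℝ) (hs : 0 < s) (V : NNReal) (hV : (V : ℝ) = s ^ 2) :
    ∫ x, max (x - v) 0 ∂(gaussianReal m V) = s * meanEx ((v - m) / s) := by
  rw [gauss_std m s V hV, integral_map (by fun_prop) (by fun_prop), meanEx,
    ← integral_const_mul]
  refine integral_congr_ae (ae_of_all _ fun x => ?_)
  simp only
  rw [mul_max_of_nonneg _ _ hs.le]
  congr 1
  · field_simp; ring
  · simp

lemma VaR_tendsto {Ω : Type*} [MeasurableSpace Ω] (P : Measure Ω) [IsProbabilityMeasure P]
    (Z : Ω → ℝ) (hZ : Measurable Z) (h : ∀ M, P.real {ω | Z ω ≤ M} < 1) :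
    Tendsto (fun p => VaR P Z p) (𝓝[<] (1 : ℝ)) atTop := by
  rw [tendsto_atTop]
  intro M
  filter_upwards [Ioo_mem_nhdsLT (h M)] with p hp
  refine le_csInf ?_ ?_
  · have : Tendsto (fun x => P.real {ω | Z ω ≤ x}) atTop (𝓝 1) := by
      have := Measure.isProbabilityMeasure_map (μ := P) hZ.aemeasurable
      refine (tendsto_cdf_atTop (P.map Z)).congr fun x => ?_
      rw [cdf_eq_real, map_measureReal_apply hZ measurableSet_Iic]; rfl
    obtain ⟨x, hx⟩ := (this.eventually (lt_mem_nhds hp.2)).exists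
    exact ⟨x, hx.le⟩
  · intro x hx
    by_contra! hlt
    have h1 : p ≤ P.real {ω | Z ω ≤ x} := hx
    have h2 : P.real {ω | Z ω ≤ x} ≤ P.real {ω | Z ω ≤ M} :=
      measureReal_mono (fun ω (hω : Z ω ≤ x) => hω.trans hlt.le)
    linarith [hp.1]

/-- Theorem 1.1 ii): if `σ₂ = ρσ₁`, then
`lim_{p ↑ 1} E(p) = σ₁√(1-ρ²)(φ(η) - η(1 - Φ(η))) ∈ (0,∞)`,
where `β = (μ₂-μ₁)/σ₁` and `η = β/√(1-ρ²)`. -/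
theorem mme_bivariate_gaussian_case_ii
    {Ω : Type*} [MeasurableSpace Ω] (P : Measure Ω) [IsProbabilityMeasure P]
    (Z1 Z2 : Ω → ℝ) (hZ1 : Measurable Z1) (hZ2 : Measurable Z2)
    (μ1 μ2 σ1 σ2 ρ : ℝ) (hσ1 : 0 < σ1) (hσ2 : 0 < σ2) (hρ1 : -1 < ρ) (hρ2 : ρ < 1)
    (hjoint : IsBiGaussian P Z1 Z2 μ1 μ2 σ1 σ2 ρ)
    (hcase : σ2 = ρ * σ1) :
    Tendsto (fun p => mme2 P Z1 Z2 p) (𝓝[<] (1 : ℝ))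
      (𝓝 (σ1 * Real.sqrt (1 - ρ ^ 2) *
        (stdNormalPDF (((μ2 - μ1) / σ1) / Real.sqrt (1 - ρ ^ 2)) -
          ((μ2 - μ1) / σ1) / Real.sqrt (1 - ρ ^ 2) *
            (1 - stdNormalCDF (((μ2 - μ1) / σ1) / Real.sqrt (1 - ρ ^ 2)))))) ∧
    0 < σ1 * Real.sqrt (1 - ρ ^ 2) *
        (stdNormalPDF (((μ2 - μ1) / σ1) / Real.sqrt (1 - ρ ^ 2)) -
          ((μ2 - μ1) / σ1) / Real.sqrt (1 - ρ ^ 2) *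
            (1 - stdNormalCDF (((μ2 - μ1) / σ1) / Real.sqrt (1 - ρ ^ 2)))) := by
  have hr : 0 < 1 - ρ ^ 2 := by nlinarith
  have ht := Real.sqrt_pos.2 hr
  set t := Real.sqrt (1 - ρ ^ 2) with htdef
  have hs : 0 < σ1 * t := by positivity
  set η := (μ2 - μ1) / σ1 / t with hη
  rw [← meanEx_formula]
  refine ⟨?_, mul_pos hs (meanEx_pos _)⟩
  obtain ⟨V1, hV1⟩ : ∃ V : NNReal, (V : ℝ) = (σ1 * t) ^ 2 := ⟨⟨_, sq_nonneg _⟩, rfl⟩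
  obtain ⟨V2, hV2⟩ : ∃ V : NNReal, (V : ℝ) = σ2 ^ 2 := ⟨⟨_, sq_nonneg _⟩, rfl⟩
  have h1 : V1 ≠ 0 := by
    rintro rfl
    have : 0 < (σ1 * t) ^ 2 := by positivity
    simp only [NNReal.coe_zero] at hV1
    linarith
  have h2 : V2 ≠ 0 := by
    rintro rfl
    have : 0 < σ2 ^ 2 := by positivity
    simp only [NNReal.coe_zero] at hV2
    linarith
  have hlaw := law_eq P Z1 Z2 hZ1 hZ2 μ1 μ2 σ1 σ2 ρ V1 V2 hσ1 hσ2 hρ1 hρ2 hjoint hcase hV1 hV2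
    h1 h2
  have hD : Measurable (fun ω => Z1 ω - Z2 ω) := hZ1.sub hZ2
  have hlD : Measure.map (fun ω => Z1 ω - Z2 ω) P = gaussianReal (μ1 - μ2) V1 := by
    have := congrArg Measure.fst hlaw
    rwa [Measure.fst_map_prodMk hZ2, Measure.fst_prod] at this
  have hlZ : Measure.map Z2 P = gaussianReal μ2 V2 := by
    have := congrArg Measure.snd hlaw
    rwa [Measure.snd_map_prodMk hD, Measure.snd_prod] at this
  have hind : IndepFun (fun ω => Z1 ω - Z2 ω) Z2 P := by
    rw [indepFun_iff_map_prod_eq_prod_map_map hD.aemeasurable hZ2.aemeasurable, hlaw, hlD, hlZ]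
  have hset : ∀ v, MeasurableSet {ω | v < Z2 ω} := fun v => hZ2 measurableSet_Ioi
  have htail : ∀ v, P.real {ω | v < Z2 ω} = 1 - stdNormalCDF ((v - μ2) / σ2) := by
    intro v
    rw [← gauss_tail μ2 σ2 v hσ2 V2 hV2, ← hlZ, map_measureReal_apply hZ2 measurableSet_Ioi]; rfl
  have hVaR : Tendsto (fun p => VaR P Z2 p) (𝓝[<] (1 : ℝ)) atTop := by
    refine VaR_tendsto P Z2 hZ2 fun M => ?_
    have e : {ω | Z2 ω ≤ M} = {ω | M < Z2 ω}ᶜ := by ext ω; simp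
    rw [e, probReal_compl_eq_one_sub (hset M), htail]
    linarith [tail_pos ((M - μ2) / σ2)]
  have hiD : Integrable (fun ω => Z1 ω - Z2 ω) P := by
    have : Integrable id (Measure.map (fun ω => Z1 ω - Z2 ω) P) := by
      rw [hlD]; exact (memLp_id_gaussianReal 1).integrable (by simp)
    exact this.comp_measurable hD
  have hiZ : Integrable Z2 P := by
    have : Integrable id (Measure.map Z2 P) := by
      rw [hlZ]; exact (memLp_id_gaussianReal 1).integrable (by simp)
    exact this.comp_measurable hZ2
  have hiZ1 : Integrable Z1 P := (hiD.add hiZ).congr (ae_of_all _ fun ω => by simp)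
  have hED : ∫ ω, max (Z1 ω - Z2 ω) 0 ∂P = σ1 * t * meanEx η := by
    have := gauss_excess (μ1 - μ2) (σ1 * t) 0 hs V1 hV1
    rw [← hlD, integral_map hD.aemeasurable (by fun_prop)] at this
    simp only [sub_zero] at this
    rw [this, hη]
    congr 2
    field_simp
    ring
  have hEZ : ∀ v, ∫ ω, max (Z2 ω - v) 0 ∂P = σ2 * meanEx ((v - μ2) / σ2) := by
    intro v
    have := gauss_excess μ2 σ2 v hσ2 V2 hV2
    rwa [← hlZ, integral_map hZ2.aemeasurable (by fun_prop)] at this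
  have hprod : ∀ v, ∫ ω in {ω | v < Z2 ω}, max (Z1 ω - Z2 ω) 0 ∂P =
      σ1 * t * meanEx η * P.real {ω | v < Z2 ω} := by
    intro v
    have := hind.integral_fun_comp_mul_comp (f := fun x : ℝ => max x 0)
      (g := (Set.Ioi v).indicator (fun _ => (1 : ℝ))) hD.aemeasurable hZ2.aemeasurable
      (by fun_prop) ((measurable_const.indicator measurableSet_Ioi).aestronglyMeasurable)
    rw [hED] at this
    rw [← integral_indicator (hset v)]
    have e2 : ∫ ω, (Set.Ioi v).indicator (fun _ => (1 : ℝ)) (Z2 ω) ∂P =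
        P.real {ω | v < Z2 ω} := by
      rw [← integral_indicator_one (hset v)]
      refine integral_congr_ae (ae_of_all _ fun ω => ?_)
      simp [Set.indicator]
    rw [← e2, ← this]
    refine integral_congr_ae (ae_of_all _ fun ω => ?_)
    simp [Set.indicator]
  have hG : Tendsto (fun v => (∫ ω in {ω | v < Z2 ω}, max (Z1 ω - v) 0 ∂P) /
      P.real {ω | v < Z2 ω}) atTop (𝓝 (σ1 * t * meanEx η)) := by
    rw [tendsto_iff_norm_sub_tendsto_zero]
    have hlim : Tendsto (fun v => σ2 / ((v - μ2) / σ2)) atTop (𝓝 0) := by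
      refine Tendsto.const_div_atTop ?_ σ2
      exact (tendsto_atTop_add_const_right _ (-μ2) tendsto_id).atTop_div_const hσ2
    refine squeeze_zero' (Eventually.of_forall fun v => norm_nonneg _) ?_ hlim
    filter_upwards [eventually_gt_atTop μ2] with v hv
    have ha : 0 < (v - μ2) / σ2 := div_pos (by linarith) hσ2
    have hT : 0 < P.real {ω | v < Z2 ω} := by rw [htail]; exact tail_pos _
    have hb := meanEx_bound ((v - μ2) / σ2)
    rw [← htail] at hb
    rw [div_sub' hT.ne', norm_div, Real.norm_of_nonneg hT.le, div_le_div_iff₀ hT ha]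
    have hi1 : Integrable (fun ω => max (Z1 ω - v) 0) P :=
      (hiZ1.sub (integrable_const v)).pos_part
    have hi2 : Integrable (fun ω => max (Z1 ω - Z2 ω) 0) P := hiD.pos_part
    have hi3 : Integrable (fun ω => max (Z2 ω - v) 0) P :=
      (hiZ.sub (integrable_const v)).pos_part
    have hmain : ‖(∫ ω in {ω | v < Z2 ω}, max (Z1 ω - v) 0 ∂P) -
        P.real {ω | v < Z2 ω} * (σ1 * t * meanEx η)‖ ≤ σ2 * meanEx ((v - μ2) / σ2) := by
      rw [mul_comm (P.real _), ← hprod, ← integral_sub hi1.integrableOn hi2.integrableOn, ← hEZ]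
      refine (norm_integral_le_of_norm_le hi3.integrableOn ?_).trans
        (setIntegral_le_integral hi3 (ae_of_all _ fun ω => le_max_right _ _))
      refine (ae_restrict_iff' (hset v)).2 (ae_of_all _ fun ω hω => ?_)
      have hω : v < Z2 ω := hω
      rw [Real.norm_eq_abs]
      refine (abs_max_sub_max_le_abs _ _ _).trans ?_
      rw [show Z1 ω - v - (Z1 ω - Z2 ω) = Z2 ω - v by ring, abs_of_pos (by linarith)]
      exact le_max_left _ _
    calc _ ≤ σ2 * meanEx ((v - μ2) / σ2) * ((v - μ2) / σ2) :=
          mul_le_mul_of_nonneg_right hmain ha.le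
      _ = σ2 * ((v - μ2) / σ2 * meanEx ((v - μ2) / σ2)) := by ring
      _ ≤ _ := mul_le_mul_of_nonneg_left hb hσ2.le
  exact hG.comp hVaR
end
end

section
/- Let (Z_1,Z_2) be jointly Gaussian with Z_i ~ N(\mu_i,\sigma_i^2) (\sigma_i>0) and correlation \rho \in (-1,1), and set u_p = \Phi^{-1}(p). If \sigma_2 < \rho\sigma_1, then the marginal mean excess satisfies E(p) \sim (\rho\sigma_1 - \sigma_2) u_p as p \uparrow 1; in particular E(p) \to \infty. -/
open MeasureTheory ProbabilityTheory Filter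
open scoped Topology ENNReal

noncomputable section

lemma aux_integrable_iff (f : ℝ → ℝ) (hf : Integrable f (gaussianReal 0 1)) :
    Integrable (fun y => gaussianPDFReal 0 1 y * f y) := by
  rw [gaussianReal_of_var_ne_zero 0 one_ne_zero,
    integrable_withDensity_iff_integrable_smul' (measurable_gaussianPDF 0 1)
      (ae_of_all _ fun x => gaussianPDF_lt_top)] at hf
  simpa [toReal_gaussianPDF] using hf

lemma aux_integrable_id : Integrable (fun y : ℝ => y) (gaussianReal 0 1) :=
  memLp_one_iff_integrable.mp (memLp_id_gaussianReal' 1 (by simp))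

lemma aux_integrable_sq : Integrable (fun y : ℝ => y ^ 2) (gaussianReal 0 1) :=
  (memLp_id_gaussianReal' (μ := 0) (v := 1) 2 (by simp)).integrable_sq

lemma aux_deriv (y : ℝ) : HasDerivAt (gaussianPDFReal 0 1) (-y * gaussianPDFReal 0 1 y) y := by
  rw [gaussianPDFReal_def]
  have h : HasDerivAt (fun x : ℝ => -(x - 0) ^ 2 / (2 * ((1 : NNReal) : ℝ))) (-y) y := by
    have := (((hasDerivAt_id y).sub_const 0).pow 2).neg.div_const (2 * ((1 : NNReal) : ℝ))
    exact this.congr_deriv (by simp; ring)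
  exact ((h.exp).const_mul ((Real.sqrt (2 * Real.pi * ((1 : NNReal) : ℝ)))⁻¹)).congr_deriv (by ring)

lemma aux_tail (u : ℝ) (hu : 1 ≤ u) :
    ∫ y in Set.Ioi u, (y - u) ∂(gaussianReal 0 1) ≤ (gaussianReal 0 1).real (Set.Ioi u) := by
  set γ := gaussianReal 0 1 with hγ
  have h1 : Integrable (fun y : ℝ => (y - u) * y - 1) γ := by
    have := (aux_integrable_sq.sub (aux_integrable_id.const_mul u)).sub (integrable_const (1 : ℝ))
    refine this.congr (ae_of_all _ fun y => ?_)
    simp; ring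
  have h2 : Integrable (fun y : ℝ => (y - u)) γ := aux_integrable_id.sub (integrable_const u)
  have h1' := aux_integrable_iff _ h1
  have h2' := aux_integrable_iff _ h2
  have hd : ∀ y ∈ Set.Ici u, HasDerivAt (fun y => -(gaussianPDFReal 0 1 y * (y - u)))
      (gaussianPDFReal 0 1 y * ((y - u) * y - 1)) y := by
    intro y _
    exact ((aux_deriv y).mul ((hasDerivAt_id y).sub_const u)).neg.congr_deriv (by simp; ring)
  have ht := tendsto_zero_of_hasDerivAt_of_integrableOn_Ioi
    (fun y hy => hd y (Set.Ioi_subset_Ici_self hy)) h1'.integrableOn h2'.neg.integrableOn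
  have h0 := integral_Ioi_of_hasDerivAt_of_tendsto' hd h1'.integrableOn ht
  have h3 : ∫ y in Set.Ioi u, ((y - u) * y - 1) ∂γ = 0 := by
    rw [← integral_indicator measurableSet_Ioi, hγ,
      integral_gaussianReal_eq_integral_smul one_ne_zero]
    simp only [smul_eq_mul]
    simp only [sub_self, mul_zero, neg_zero] at h0
    rw [← integral_indicator measurableSet_Ioi] at h0
    refine Eq.trans ?_ h0
    congr 1; ext y
    by_cases hy : y ∈ Set.Ioi u <;> simp [hy]
  have h4 : ∫ y in Set.Ioi u, (y - u) ∂γ ≤ ∫ y in Set.Ioi u, (((y - u) * y - 1) + 1) ∂γ := by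
    refine setIntegral_mono_on h2.integrableOn (h1.add (integrable_const (1:ℝ))).integrableOn
      measurableSet_Ioi fun y hy => ?_
    have : u < y := hy
    nlinarith
  rw [integral_add h1.integrableOn (integrable_const _), h3] at h4
  simpa using h4

lemma aux_pdf (μ1 μ2 σ1 σ2 ρ : ℝ) (hσ1 : 0 < σ1) (hσ2 : 0 < σ2) (hρ1 : -1 < ρ) (hρ2 : ρ < 1)
    (x z : ℝ) :
    biGaussPDF μ1 μ2 σ1 σ2 ρ (x, z) =
      gaussianPDFReal μ2 (NNReal.mk (σ2 ^ 2) (sq_nonneg _)) z *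
      gaussianPDFReal (μ1 + σ1 * (ρ * ((z - μ2) / σ2)))
        (NNReal.mk ((σ1 * Real.sqrt (1 - ρ ^ 2)) ^ 2) (sq_nonneg _)) x := by
  have hs : 0 < 1 - ρ ^ 2 := by nlinarith
  unfold biGaussPDF biStdGaussPDF gaussianPDFReal
  simp only [NNReal.coe_mk]
  have e1 : Real.sqrt (2 * Real.pi * σ2 ^ 2) = Real.sqrt (2 * Real.pi) * σ2 := by
    rw [Real.sqrt_mul (by positivity), Real.sqrt_sq hσ2.le]
  have e2 : Real.sqrt (2 * Real.pi * (σ1 * Real.sqrt (1 - ρ ^ 2)) ^ 2)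
      = Real.sqrt (2 * Real.pi) * (σ1 * Real.sqrt (1 - ρ ^ 2)) := by
    rw [Real.sqrt_mul (by positivity), Real.sqrt_sq (by positivity)]
  rw [e1, e2, mul_pow σ1, Real.sq_sqrt hs.le]
  have e3 : Real.sqrt (2 * Real.pi) * Real.sqrt (2 * Real.pi) = 2 * Real.pi :=
    Real.mul_self_sqrt (by positivity)
  rw [mul_mul_mul_comm, ← mul_inv, ← Real.exp_add, ← mul_assoc]
  congr 1
  · rw [← mul_inv]; congr 1; linear_combination (-(σ1 * σ2 * Real.sqrt (1 - ρ ^ 2))) * e3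
  · congr 1
    field_simp
    ring

/-- The linear map. -/
def auxT (μ1 μ2 σ1 σ2 ρ : ℝ) (w : ℝ × ℝ) : ℝ × ℝ :=
  (μ1 + σ1 * (ρ * w.2) + σ1 * Real.sqrt (1 - ρ ^ 2) * w.1, μ2 + σ2 * w.2)

lemma aux_affine (m c : ℝ) : (gaussianReal 0 1).map (fun w => m + c * w)
    = gaussianReal m (NNReal.mk (c ^ 2) (sq_nonneg _)) := by
  have : (fun w : ℝ => m + c * w) = (fun w => m + w) ∘ (fun w => c * w) := rfl
  rw [this, ← Measure.map_map (by fun_prop) (by fun_prop), gaussianReal_map_const_mul,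
    gaussianReal_map_const_add]
  simp

lemma aux_law (μ1 μ2 σ1 σ2 ρ : ℝ) (hσ1 : 0 < σ1) (hσ2 : 0 < σ2) (hρ1 : -1 < ρ) (hρ2 : ρ < 1) :
    ((gaussianReal 0 1).prod (gaussianReal 0 1)).map (auxT μ1 μ2 σ1 σ2 ρ) =
    (volume : Measure (ℝ × ℝ)).withDensity
      fun z => ENNReal.ofReal (biGaussPDF μ1 μ2 σ1 σ2 ρ z) := by
  have hs : 0 < Real.sqrt (1 - ρ ^ 2) := Real.sqrt_pos.mpr (by nlinarith)
  have hT : Measurable (auxT μ1 μ2 σ1 σ2 ρ) := by unfold auxT; fun_prop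
  have hv1 : ((NNReal.mk ((σ1 * Real.sqrt (1 - ρ ^ 2)) ^ 2) (sq_nonneg _)) : NNReal) ≠ 0 := by
    intro h; have := congrArg NNReal.toReal h; simp at this; rcases this with h | h <;> linarith
  have hv2 : ((NNReal.mk (σ2 ^ 2) (sq_nonneg _)) : NNReal) ≠ 0 := by
    intro h; have := congrArg NNReal.toReal h; simp at this; linarith
  have hpm : Measurable (fun z => ENNReal.ofReal (biGaussPDF μ1 μ2 σ1 σ2 ρ z)) := by
    unfold biGaussPDF biStdGaussPDF; fun_prop
  refine Measure.ext_of_lintegral _ fun f hf => ?_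
  rw [lintegral_map hf hT, lintegral_prod_symm' (fun a => f (auxT μ1 μ2 σ1 σ2 ρ a)) (hf.comp hT),
    lintegral_withDensity_eq_lintegral_mul _ hpm hf, Measure.volume_eq_prod,
    lintegral_prod_symm' _ (hpm.mul hf)]
  have hG : Measurable (fun z : ℝ => ∫⁻ x, gaussianPDF (μ1 + σ1 * (ρ * ((z - μ2) / σ2)))
        (NNReal.mk ((σ1 * Real.sqrt (1 - ρ ^ 2)) ^ 2) (sq_nonneg _)) x * f (x, z)) := by
    apply Measurable.lintegral_prod_right'
      (f := fun q : ℝ × ℝ => gaussianPDF (μ1 + σ1 * (ρ * ((q.1 - μ2) / σ2)))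
        (NNReal.mk ((σ1 * Real.sqrt (1 - ρ ^ 2)) ^ 2) (sq_nonneg _)) q.2 * f (q.2, q.1))
    refine Measurable.mul ?_ (by fun_prop)
    unfold gaussianPDF gaussianPDFReal
    fun_prop
  have key : ∀ y : ℝ, ∫⁻ w, f (auxT μ1 μ2 σ1 σ2 ρ (w, y)) ∂(gaussianReal 0 1)
      = (fun z : ℝ => ∫⁻ x, gaussianPDF (μ1 + σ1 * (ρ * ((z - μ2) / σ2)))
        (NNReal.mk ((σ1 * Real.sqrt (1 - ρ ^ 2)) ^ 2) (sq_nonneg _)) x * f (x, z)) (μ2 + σ2 * y) := by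
    intro y
    have h1 := lintegral_map (μ := gaussianReal 0 1) (f := fun x => f (x, μ2 + σ2 * y))
      (g := fun w => (μ1 + σ1 * (ρ * y)) + (σ1 * Real.sqrt (1 - ρ ^ 2)) * w)
      (by fun_prop) (by fun_prop)
    rw [aux_affine, gaussianReal_of_var_ne_zero _ hv1,
      lintegral_withDensity_eq_lintegral_mul _ (measurable_gaussianPDF _ _) (by fun_prop)] at h1
    have e : (μ2 + σ2 * y - μ2) / σ2 = y := by field_simp; ring
    simp only [e]
    exact h1.symm
  simp only [key]
  rw [← lintegral_map (μ := gaussianReal 0 1) (g := fun w => μ2 + σ2 * w) hG (by fun_prop),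
    aux_affine, gaussianReal_of_var_ne_zero _ hv2,
      lintegral_withDensity_eq_lintegral_mul _ (measurable_gaussianPDF _ _) hG]
  refine lintegral_congr fun z => ?_
  simp only [Pi.mul_apply]
  rw [← lintegral_const_mul']
  · refine lintegral_congr fun x => ?_
    rw [aux_pdf μ1 μ2 σ1 σ2 ρ hσ1 hσ2 hρ1 hρ2, ENNReal.ofReal_mul (gaussianPDFReal_nonneg _ _ _),
      mul_assoc]
    rfl
  · exact gaussianPDF_ne_top

lemma aux_cdf_eq (x : ℝ) : stdNormalCDF x = cdf (gaussianReal 0 1) x := by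
  rw [cdf_eq_real]; rfl

lemma aux_Ioi_pos (u : ℝ) : 0 < (gaussianReal 0 1).real (Set.Ioi u) := by
  rw [measureReal_def, ENNReal.toReal_pos_iff]
  refine ⟨pos_iff_ne_zero.mpr fun h => ?_, measure_lt_top _ _⟩
  have := gaussianReal_absolutelyContinuous' 0 (one_ne_zero (α := NNReal)) h
  simp at this

lemma aux_cdf_lt (x : ℝ) : stdNormalCDF x < 1 := by
  have h := aux_Ioi_pos x
  rw [← Set.compl_Iic, probReal_compl_eq_one_sub measurableSet_Iic] at h
  unfold stdNormalCDF
  rw [measureReal_def] at h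
  linarith

lemma aux_glb (p : ℝ) (h0 : 0 < p) (h1 : p < 1) :
    {x : ℝ | p ≤ stdNormalCDF x}.Nonempty ∧
    IsGLB {x : ℝ | p ≤ stdNormalCDF x} (stdNormalQuantile p) := by
  have hne : {x : ℝ | p ≤ stdNormalCDF x}.Nonempty := by
    obtain ⟨x, hx⟩ := ((tendsto_cdf_atTop (gaussianReal 0 1)).eventually (lt_mem_nhds h1)).exists
    exact ⟨x, by simpa [aux_cdf_eq] using hx.le⟩
  refine ⟨hne, isGLB_csInf hne ?_⟩
  obtain ⟨x, hx⟩ := ((tendsto_cdf_atBot (gaussianReal 0 1)).eventually (gt_mem_nhds h0)).exists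
  refine ⟨x, fun y hy => ?_⟩
  by_contra hlt
  have := monotone_cdf (gaussianReal 0 1) (not_le.mp hlt).le
  simp only [Set.mem_ofPred_eq, aux_cdf_eq] at hy
  linarith

lemma aux_quantile_tendsto : Tendsto stdNormalQuantile (𝓝[<] (1 : ℝ)) atTop := by
  rw [tendsto_atTop]
  intro M
  have h1 : ∀ᶠ p in 𝓝[<] (1 : ℝ), max 0 (stdNormalCDF M) < p :=
    eventually_nhdsWithin_of_eventually_nhds
      (lt_mem_nhds (max_lt one_pos (aux_cdf_lt M)))
  filter_upwards [h1, self_mem_nhdsWithin] with p hp hp1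
  have hp0 : 0 < p := (le_max_left _ _).trans_lt hp
  have hpM : stdNormalCDF M < p := (le_max_right _ _).trans_lt hp
  refine (aux_glb p hp0 hp1).2.2 fun y hy => ?_
  by_contra hlt
  have := monotone_cdf (gaussianReal 0 1) (not_le.mp hlt).le
  simp only [Set.mem_ofPred_eq, aux_cdf_eq] at hy hpM
  linarith

lemma aux_main_bound (a b c s u : ℝ) (ha : 0 < a) (hb : 0 < b) (hs : 0 < s) (hsa : s < a)
    (hu : 1 ≤ u) :
    (c + (a - s) * u) * (gaussianReal 0 1).real (Set.Ioi u) ≤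
      ∫ w in Set.univ ×ˢ Set.Ioi u, max (c + a * w.2 - s * u + b * w.1) 0
        ∂((gaussianReal 0 1).prod (gaussianReal 0 1)) ∧
    ∫ w in Set.univ ×ˢ Set.Ioi u, max (c + a * w.2 - s * u + b * w.1) 0
        ∂((gaussianReal 0 1).prod (gaussianReal 0 1)) ≤
    (|c| + a + b * (∫ x, |x| ∂(gaussianReal 0 1)) + (a - s) * u) *
      (gaussianReal 0 1).real (Set.Ioi u) := by
  rw [← Measure.prod_restrict, Measure.restrict_univ]
  set γ := gaussianReal 0 1 with hγ
  set ν := γ.restrict (Set.Ioi u) with hν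
  have hνu : ν.real Set.univ = γ.real (Set.Ioi u) := by simp [hν]
  have i1 : Integrable (fun w : ℝ × ℝ => w.1) (γ.prod ν) := aux_integrable_id.comp_fst ν
  have i2 : Integrable (fun w : ℝ × ℝ => |w.1|) (γ.prod ν) := aux_integrable_id.abs.comp_fst ν
  have i3 : Integrable (fun y : ℝ => y - u) ν :=
    (aux_integrable_id.sub (integrable_const u)).integrableOn
  have i3' : Integrable (fun w : ℝ × ℝ => w.2 - u) (γ.prod ν) := i3.comp_snd γ
  have hae : ∀ᵐ w ∂(γ.prod ν), u < w.2 := by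
    have : γ.prod ν = (γ.prod γ).restrict (Set.univ ×ˢ Set.Ioi u) := by
      rw [← Measure.prod_restrict, Measure.restrict_univ]
    rw [this]
    filter_upwards [ae_restrict_mem (MeasurableSet.univ.prod measurableSet_Ioi)] with w hw
    exact hw.2
  have im : Integrable (fun w : ℝ × ℝ => max (c + a * w.2 - s * u + b * w.1) 0) (γ.prod ν) := by
    have : Integrable (fun w : ℝ × ℝ => c + a * w.2 - s * u + b * w.1) (γ.prod ν) := by
      have := ((integrable_const (c + (a - s) * u)).add (i3'.const_mul a)).add (i1.const_mul b)
      refine this.congr (ae_of_all _ fun w => ?_)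
      simp; ring
    exact this.pos_part
  constructor
  · have hl : ∫ w, ((c + (a - s) * u) + b * w.1) ∂(γ.prod ν)
        = (c + (a - s) * u) * γ.real (Set.Ioi u) := by
      rw [integral_add (integrable_const _) (i1.const_mul b), integral_const_mul,
        integral_fun_fst (fun x : ℝ => x), integral_id_gaussianReal]
      simp [measureReal_def, Measure.prod_apply, hν, mul_comm]
    rw [← hl]
    refine integral_mono_ae ((integrable_const _).add (i1.const_mul b)) im ?_
    filter_upwards [hae] with w hw
    refine le_max_of_le_left ?_
    nlinarith
  · have hl : ∫ w, ((|c| + (a - s) * u) + a * (w.2 - u) + b * |w.1|) ∂(γ.prod ν)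
        = (|c| + (a - s) * u) * γ.real (Set.Ioi u) + a * (∫ y in Set.Ioi u, (y - u) ∂γ)
          + b * ((∫ x, |x| ∂γ) * γ.real (Set.Ioi u)) := by
      have i4 : Integrable (fun w : ℝ × ℝ => (|c| + (a - s) * u) + a * (w.2 - u)) (γ.prod ν) :=
        (integrable_const _).add (i3'.const_mul a)
      rw [integral_add i4 (i2.const_mul b),
        integral_add (integrable_const _) (i3'.const_mul a), integral_const_mul, integral_const_mul,
        integral_fun_fst (fun x : ℝ => |x|), integral_fun_snd (fun x : ℝ => x - u), hνu]
      simp [measureReal_def, Measure.prod_apply, hν, mul_comm]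
    calc _ ≤ ∫ w, ((|c| + (a - s) * u) + a * (w.2 - u) + b * |w.1|) ∂(γ.prod ν) := by
          refine integral_mono_ae im
            (((integrable_const _).add (i3'.const_mul a)).add (i2.const_mul b)) ?_
          filter_upwards [hae] with w hw
          have h1 := le_abs_self c
          have h2 := mul_le_mul_of_nonneg_left (le_abs_self w.1) hb.le
          have h3 : 0 ≤ (a - s) * u := mul_nonneg (by linarith) (by linarith)
          have h4 : 0 ≤ a * (w.2 - u) := mul_nonneg ha.le (by linarith)
          refine max_le ?_ ?_
          · linarith
          · positivity
      _ ≤ _ := by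
          rw [hl]
          have := mul_le_mul_of_nonneg_left (aux_tail u hu) ha.le
          rw [← hγ] at this
          linarith

lemma aux_VaR_s2 {Ω : Type*} [MeasurableSpace Ω] (P : Measure Ω)
    (Z1 Z2 : Ω → ℝ) (hZ1 : Measurable Z1) (hZ2 : Measurable Z2)
    (μ1 μ2 σ1 σ2 ρ : ℝ) (hσ2 : 0 < σ2)
    (hlaw : Measure.map (fun ω => (Z1 ω, Z2 ω)) P =
      ((gaussianReal 0 1).prod (gaussianReal 0 1)).map (auxT μ1 μ2 σ1 σ2 ρ))
    (p : ℝ) (hp0 : 0 < p) (hp1 : p < 1) :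
    VaR P Z2 p = μ2 + σ2 * stdNormalQuantile p := by
  have hT : Measurable (auxT μ1 μ2 σ1 σ2 ρ) := by unfold auxT; fun_prop
  have hcdf : ∀ x, (P {ω | Z2 ω ≤ x}).toReal = stdNormalCDF ((x - μ2) / σ2) := by
    intro x
    have h := congrArg (fun m => m (Set.univ ×ˢ Set.Iic x)) hlaw
    rw [Measure.map_apply (by fun_prop) (MeasurableSet.univ.prod measurableSet_Iic),
      Measure.map_apply hT (MeasurableSet.univ.prod measurableSet_Iic)] at h
    have e1 : (fun ω => (Z1 ω, Z2 ω)) ⁻¹' (Set.univ ×ˢ Set.Iic x) = {ω | Z2 ω ≤ x} := by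
      ext ω; simp
    have e2 : auxT μ1 μ2 σ1 σ2 ρ ⁻¹' (Set.univ ×ˢ Set.Iic x)
        = Set.univ ×ˢ Set.Iic ((x - μ2) / σ2) := by
      ext w
      simp only [auxT, Set.mem_preimage, Set.mem_prod, Set.mem_univ, Set.mem_Iic, true_and]
      rw [le_div_iff₀ hσ2]
      constructor <;> intro h <;> linarith
    rw [e1, e2, Measure.prod_prod, measure_univ, one_mul] at h
    rw [h]; rfl
  obtain ⟨⟨y, hy⟩, hg⟩ := aux_glb p hp0 hp1
  unfold VaR
  simp only [hcdf]
  refine IsGLB.csInf_eq ⟨fun x hx => ?_, fun m hm => ?_⟩ ⟨μ2 + σ2 * y, ?_⟩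
  · have := hg.1 (show (x - μ2) / σ2 ∈ {x : ℝ | p ≤ stdNormalCDF x} from hx)
    rw [le_div_iff₀ hσ2] at this
    linarith
  · have : (m - μ2) / σ2 ≤ stdNormalQuantile p := by
      refine hg.2 fun z hz => ?_
      have := hm (show μ2 + σ2 * z ∈ {x : ℝ | p ≤ stdNormalCDF ((x - μ2) / σ2)} by
        have e : (μ2 + σ2 * z - μ2) / σ2 = z := by field_simp; ring
        simp only [Set.mem_ofPred_eq, e]; exact hz)
      rw [div_le_iff₀ hσ2]; linarith
    rw [div_le_iff₀ hσ2] at this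
    linarith
  · have e : (μ2 + σ2 * y - μ2) / σ2 = y := by field_simp; ring
    simp only [Set.mem_ofPred_eq, e]; exact hy

lemma aux_mme {Ω : Type*} [MeasurableSpace Ω] (P : Measure Ω)
    (Z1 Z2 : Ω → ℝ) (hZ1 : Measurable Z1) (hZ2 : Measurable Z2)
    (μ1 μ2 σ1 σ2 ρ : ℝ) (hσ2 : 0 < σ2)
    (hlaw : Measure.map (fun ω => (Z1 ω, Z2 ω)) P =
      ((gaussianReal 0 1).prod (gaussianReal 0 1)).map (auxT μ1 μ2 σ1 σ2 ρ))
    (p : ℝ) (hp0 : 0 < p) (hp1 : p < 1) :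
    mme2 P Z1 Z2 p = (∫ w in Set.univ ×ˢ Set.Ioi (stdNormalQuantile p),
      max ((μ1 - μ2) + (ρ * σ1) * w.2 - σ2 * stdNormalQuantile p
        + (σ1 * Real.sqrt (1 - ρ ^ 2)) * w.1) 0 ∂((gaussianReal 0 1).prod (gaussianReal 0 1))) /
      (gaussianReal 0 1).real (Set.Ioi (stdNormalQuantile p)) := by
  have hT : Measurable (auxT μ1 μ2 σ1 σ2 ρ) := by unfold auxT; fun_prop
  have hZ : Measurable (fun ω => (Z1 ω, Z2 ω)) := by fun_prop
  unfold mme2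
  rw [aux_VaR_s2 P Z1 Z2 hZ1 hZ2 μ1 μ2 σ1 σ2 ρ hσ2 hlaw p hp0 hp1]
  set u := stdNormalQuantile p
  set v := μ2 + σ2 * u with hv
  have hS : MeasurableSet (Set.univ ×ˢ Set.Ioi v : Set (ℝ × ℝ)) :=
    MeasurableSet.univ.prod measurableSet_Ioi
  have e1 : (fun ω => (Z1 ω, Z2 ω)) ⁻¹' (Set.univ ×ˢ Set.Ioi v) = {ω | v < Z2 ω} := by
    ext ω; simp
  have e2 : auxT μ1 μ2 σ1 σ2 ρ ⁻¹' (Set.univ ×ˢ Set.Ioi v) = Set.univ ×ˢ Set.Ioi u := by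
    ext w
    simp [auxT, hv, hσ2]
  have hm : Measurable (fun z : ℝ × ℝ => max (z.1 - v) 0) := by fun_prop
  congr 1
  · have h1 := setIntegral_map (μ := P) hS (hm.aestronglyMeasurable) hZ.aemeasurable
    have h2 := setIntegral_map (μ := (gaussianReal 0 1).prod (gaussianReal 0 1)) hS
      (hm.aestronglyMeasurable) hT.aemeasurable
    rw [hlaw, h2, e1, e2] at h1
    rw [← h1]
    congr 1; ext w
    simp only [auxT, hv]
    congr 1; ring
  · have h := congrArg (fun m => m (Set.univ ×ˢ Set.Ioi v)) hlaw
    rw [Measure.map_apply hZ hS, Measure.map_apply hT hS, e1, e2, Measure.prod_prod,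
      measure_univ, one_mul] at h
    rw [h]; rfl

/-- Theorem 1.1 iii): if `σ₂ < ρσ₁`, then `E(p) ~ (ρσ₁ - σ₂) u_p` as `p ↑ 1`;
in particular `E(p) → ∞`. -/
theorem mme_bivariate_gaussian_case_iii
    {Ω : Type*} [MeasurableSpace Ω] (P : Measure Ω) [IsProbabilityMeasure P]
    (Z1 Z2 : Ω → ℝ) (hZ1 : Measurable Z1) (hZ2 : Measurable Z2)
    (μ1 μ2 σ1 σ2 ρ : ℝ) (hσ1 : 0 < σ1) (hσ2 : 0 < σ2) (hρ1 : -1 < ρ) (hρ2 : ρ < 1)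
    (hjoint : IsBiGaussian P Z1 Z2 μ1 μ2 σ1 σ2 ρ)
    (hcase : σ2 < ρ * σ1) :
    Tendsto (fun p => mme2 P Z1 Z2 p / ((ρ * σ1 - σ2) * stdNormalQuantile p))
      (𝓝[<] (1 : ℝ)) (𝓝 1) ∧
    Tendsto (fun p => mme2 P Z1 Z2 p) (𝓝[<] (1 : ℝ)) atTop := by
  have hlaw : Measure.map (fun ω => (Z1 ω, Z2 ω)) P =
      ((gaussianReal 0 1).prod (gaussianReal 0 1)).map (auxT μ1 μ2 σ1 σ2 ρ) := by
    rw [aux_law μ1 μ2 σ1 σ2 ρ hσ1 hσ2 hρ1 hρ2]; exact hjoint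
  have hs : 0 < σ1 * Real.sqrt (1 - ρ ^ 2) := mul_pos hσ1 (Real.sqrt_pos.mpr (by nlinarith))
  have hd : 0 < ρ * σ1 - σ2 := by linarith
  set d := ρ * σ1 - σ2 with hdd
  obtain ⟨C, D, hCD⟩ : ∃ C D : ℝ, ∀ᶠ p in 𝓝[<] (1 : ℝ),
      C + d * stdNormalQuantile p ≤ mme2 P Z1 Z2 p ∧
      mme2 P Z1 Z2 p ≤ D + d * stdNormalQuantile p := by
    refine ⟨μ1 - μ2, |μ1 - μ2| + ρ * σ1 + (σ1 * Real.sqrt (1 - ρ ^ 2)) *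
      (∫ x, |x| ∂(gaussianReal 0 1)), ?_⟩
    have h0 : ∀ᶠ p in 𝓝[<] (1 : ℝ), 0 < p :=
      eventually_nhdsWithin_of_eventually_nhds (lt_mem_nhds one_pos)
    filter_upwards [h0, self_mem_nhdsWithin, aux_quantile_tendsto.eventually_ge_atTop 1]
      with p hp0 hp1 hu
    rw [aux_mme P Z1 Z2 hZ1 hZ2 μ1 μ2 σ1 σ2 ρ hσ2 hlaw p hp0 hp1]
    have hb := aux_main_bound (ρ * σ1) (σ1 * Real.sqrt (1 - ρ ^ 2)) (μ1 - μ2) σ2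
      (stdNormalQuantile p) (by linarith) hs hσ2 hcase hu
    have hpos := aux_Ioi_pos (stdNormalQuantile p)
    rw [le_div_iff₀ hpos, div_le_iff₀ hpos]
    exact hb
  have hdu : Tendsto (fun p => d * stdNormalQuantile p) (𝓝[<] (1 : ℝ)) atTop :=
    aux_quantile_tendsto.const_mul_atTop hd
  constructor
  · have hlim : ∀ K : ℝ, Tendsto (fun p => K / (d * stdNormalQuantile p) + 1)
        (𝓝[<] (1 : ℝ)) (𝓝 1) := by
      intro K
      simpa using (hdu.const_div_atTop K).add_const 1
    refine tendsto_of_tendsto_of_tendsto_of_le_of_le' (hlim C) (hlim D) ?_ ?_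
    · filter_upwards [hCD, hdu.eventually_gt_atTop 0] with p hp hpos
      rw [le_div_iff₀ hpos, add_mul, div_mul_cancel₀ _ hpos.ne', one_mul]
      exact hp.1
    · filter_upwards [hCD, hdu.eventually_gt_atTop 0] with p hp hpos
      rw [div_le_iff₀ hpos, add_mul, div_mul_cancel₀ _ hpos.ne', one_mul]
      exact hp.2
  · exact tendsto_atTop_mono' _ (hCD.mono fun p hp => hp.1)
      (tendsto_atTop_add_const_left _ C hdu)
end
end

section
/- Let X be a centered d-dimensional Gaussian random vector with non-singular correlation matrix \Sigma, let \mu \in R and let c \in R^d have at least one positive component, with I and L the index sets determined by the quadratic programming problem \Pi_\Sigma(c). If 1 \in I, then as u \to \infty, E(c,u) \sim (1/(c_I^T (\Sigma_{II})^{-1} e_1)) \cdot P(X_1 > c_1 u + \mu, X_{-1} > c_{-1} u) / ( u \, P(X_{-1} > c_{-1} u) ); in particular E(c,u) \to 0. -/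
open MeasureTheory ProbabilityTheory Filter Matrix
open scoped Topology ENNReal

noncomputable section

/-- Submatrix of `A` keeping rows with indices in `I` and columns with indices in `J`. -/
def subM {ι : Type*} (A : Matrix ι ι ℝ) (I J : Finset ι) : Matrix ↥I ↥J ℝ :=
  fun i j => A i j

/-- Subvector of `c` keeping the entries with indices in `I`. -/
def subV {ι : Type*} (c : ι → ℝ) (I : Finset ι) : ↥I → ℝ := fun i => c i

/-- Density of a centered Gaussian vector with covariance matrix `S`. -/
def gaussPDF {ι : Type*} [Fintype ι] [DecidableEq ι] (S : Matrix ι ι ℝ) (x : ι → ℝ) : ℝ :=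
  (Real.sqrt ((2 * Real.pi) ^ Fintype.card ι * S.det))⁻¹ *
    Real.exp (-(x ⬝ᵥ S⁻¹.mulVec x) / 2)

/-- `X` is, under `P`, a centered Gaussian random vector with covariance matrix `S`. -/
def IsCenteredGaussianRV {Ω ι : Type*} [MeasurableSpace Ω] [Fintype ι] [DecidableEq ι]
    (P : Measure Ω) (X : Ω → ι → ℝ) (S : Matrix ι ι ℝ) : Prop :=
  Measure.map X P =
    (volume : Measure (ι → ℝ)).withDensity fun x => ENNReal.ofReal (gaussPDF S x)

/-- `bt` is a solution of the quadratic programming problem `Π_A(c)`: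
minimise `x ⬝ Σ⁻¹ x` under `x ≥ c`. -/
def IsQPSol {ι : Type*} [Fintype ι] [DecidableEq ι] (A : Matrix ι ι ℝ) (c bt : ι → ℝ) : Prop :=
  (∀ i, c i ≤ bt i) ∧
    ∀ x : ι → ℝ, (∀ i, c i ≤ x i) → bt ⬝ᵥ A⁻¹.mulVec bt ≤ x ⬝ᵥ A⁻¹.mulVec x

/-- `I` is the index set determined by the quadratic programming problem `Π_A(c)`
with solution `bt`. -/
def IsQPIndex {ι : Type*} [Fintype ι] [DecidableEq ι] (A : Matrix ι ι ℝ)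
    (c bt : ι → ℝ) (I : Finset ι) : Prop :=
  I.Nonempty ∧ (∀ i ∈ I, bt i = c i) ∧
    (∀ i : ↥I, 0 < (subM A I I)⁻¹.mulVec (subV c I) i) ∧
    ∀ j : ι, j ∉ I → bt j = (fun i : ↥I => A j i) ⬝ᵥ (subM A I I)⁻¹.mulVec (subV c I)

/-- `Σ_{i₀,I} (Σ_{II})⁻¹ c_I`. -/
def rowDot {ι : Type*} [Fintype ι] [DecidableEq ι] (A : Matrix ι ι ℝ) (c : ι → ℝ)
    (I : Finset ι) (i0 : ι) : ℝ :=
  (fun i : ↥I => A i0 i) ⬝ᵥ (subM A I I)⁻¹.mulVec (subV c I)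

/-- `c_I ⬝ (Σ_{II})⁻¹ e_{i₀}`. -/
def eDot {ι : Type*} [Fintype ι] [DecidableEq ι] (A : Matrix ι ι ℝ) (c : ι → ℝ)
    (I : Finset ι) (i0 : ι) : ℝ :=
  subV c I ⬝ᵥ (subM A I I)⁻¹.mulVec fun j : ↥I => if (j : ι) = i0 then 1 else 0

/-- Schur complement `Σ_{I^cI^c} - Σ_{I^cI}(Σ_{II})⁻¹Σ_{II^c}`, the covariance matrix of the
conditional Gaussian distribution of `X_{I^c}` given `X_I`. -/
def schurC {ι : Type*} [Fintype ι] [DecidableEq ι] (A : Matrix ι ι ℝ) (I : Finset ι) :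
    Matrix ↥Iᶜ ↥Iᶜ ℝ :=
  subM A Iᶜ Iᶜ - subM A Iᶜ I * (subM A I I)⁻¹ * subM A I Iᶜ

/-- The conditional law of `X_{I^c}` given `X_I = 0`. -/
def condNu {ι : Type*} [Fintype ι] [DecidableEq ι] (A : Matrix ι ι ℝ) (I : Finset ι) :
    Measure (↥Iᶜ → ℝ) :=
  (volume : Measure (↥Iᶜ → ℝ)).withDensity fun y => ENNReal.ofReal (gaussPDF (schurC A I) y)

/-- Survival function `Ḡ(x) = P(X_{i₀} > x, X_{N*} > 0 | X_I = 0) / P(X_{N*} > 0 | X_I = 0)`. -/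
def Gbar {ι : Type*} [Fintype ι] [DecidableEq ι] (A : Matrix ι ι ℝ) (I Nstar : Finset ι)
    (i0 : ι) (x : ℝ) : ℝ :=
  (condNu A I {y : ↥Iᶜ → ℝ | (∀ j : ↥Iᶜ, (j : ι) = i0 → x < y j) ∧
      ∀ j : ↥Iᶜ, (j : ι) ∈ Nstar → 0 < y j}).toReal /
    (condNu A I {y : ↥Iᶜ → ℝ | ∀ j : ↥Iᶜ, (j : ι) ∈ Nstar → 0 < y j}).toReal

/-- `E[(Y - μ)₊]` where `Y` has survival function `Gbar A I Nstar i0`. -/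
def condPlusMean {ι : Type*} [Fintype ι] [DecidableEq ι] (A : Matrix ι ι ℝ)
    (I Nstar : Finset ι) (i0 : ι) (μ : ℝ) : ℝ :=
  (∫ y in {y : ↥Iᶜ → ℝ | ∀ j : ↥Iᶜ, (j : ι) ∈ Nstar → 0 < y j},
      max ((∑ j : ↥Iᶜ, if (j : ι) = i0 then y j else 0) - μ) 0 ∂(condNu A I)) /
    (condNu A I {y : ↥Iᶜ → ℝ | ∀ j : ↥Iᶜ, (j : ι) ∈ Nstar → 0 < y j}).toReal

/-- `E[Y]` where `Y` has survival function `Gbar A I Nstar i0`. -/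
def condMean {ι : Type*} [Fintype ι] [DecidableEq ι] (A : Matrix ι ι ℝ)
    (I Nstar : Finset ι) (i0 : ι) : ℝ :=
  (∫ y in {y : ↥Iᶜ → ℝ | ∀ j : ↥Iᶜ, (j : ι) ∈ Nstar → 0 < y j},
      (∑ j : ↥Iᶜ, if (j : ι) = i0 then y j else 0) ∂(condNu A I)) /
    (condNu A I {y : ↥Iᶜ → ℝ | ∀ j : ↥Iᶜ, (j : ι) ∈ Nstar → 0 < y j}).toReal

/-- The conditioning event `{X_2 > c_2 u, ..., X_d > c_d u}`. -/
def tailEvent {Ω : Type*} {d : ℕ} [NeZero d] (X : Ω → Fin d → ℝ) (c : Fin d → ℝ) (u : ℝ) :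
    Set Ω := {ω | ∀ i : Fin d, i ≠ 0 → c i * u < X ω i}

/-- The marginal mean excess `E(c,u) = E[(X_1 - c_1 u - μ)₊ | X_2 > c_2 u, ..., X_d > c_d u]`. -/
def mmeV {Ω : Type*} [MeasurableSpace Ω] {d : ℕ} [NeZero d] (P : Measure Ω)
    (X : Ω → Fin d → ℝ) (c : Fin d → ℝ) (μ u : ℝ) : ℝ :=
  (∫ ω in tailEvent X c u, max (X ω 0 - c 0 * u - μ) 0 ∂P) / (P (tailEvent X c u)).toReal

/-- The marginal expected shortfall `S(c,u) = E[X_1 | X_2 > c_2 u, ..., X_d > c_d u]`. -/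
def mesV {Ω : Type*} [MeasurableSpace Ω] {d : ℕ} [NeZero d] (P : Measure Ω)
    (X : Ω → Fin d → ℝ) (c : Fin d → ℝ) (u : ℝ) : ℝ :=
  (∫ ω in tailEvent X c u, X ω 0 ∂P) / (P (tailEvent X c u)).toReal

/-- The multivariate conditional tail expectation `M(c,u) = E[X_1 | X > c u]`. -/
def mcteV {Ω : Type*} [MeasurableSpace Ω] {d : ℕ} [NeZero d] (P : Measure Ω)
    (X : Ω → Fin d → ℝ) (c : Fin d → ℝ) (u : ℝ) : ℝ :=
  (∫ ω in {ω | ∀ i, c i * u < X ω i}, X ω 0 ∂P) / (P {ω | ∀ i, c i * u < X ω i}).toReal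

theorem quad_coercive {d : ℕ} [NeZero d] (B : Matrix (Fin d) (Fin d) ℝ) (hB : B.PosDef) :
    ∃ κ : ℝ, 0 < κ ∧ ∀ y : Fin d → ℝ, κ * ∑ i, y i ^ 2 ≤ y ⬝ᵥ B.mulVec y := by
  have hcont : Continuous fun y : Fin d → ℝ => y ⬝ᵥ B.mulVec y := by
    fun_prop
  have hne : (Metric.sphere (0 : Fin d → ℝ) 1).Nonempty := by
    refine ⟨fun _ => 1, ?_⟩
    simp
  obtain ⟨y0, hy0, hmin⟩ := (isCompact_sphere (0 : Fin d → ℝ) 1).exists_isMinOn hne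
    hcont.continuousOn
  have hy0' : y0 ≠ 0 := by
    rintro rfl
    simp at hy0
  have hm : 0 < y0 ⬝ᵥ B.mulVec y0 := by
    simpa using hB.dotProduct_mulVec_pos hy0'
  have hd : (0 : ℝ) < d := by
    exact_mod_cast Nat.pos_of_ne_zero (NeZero.ne d)
  set m := y0 ⬝ᵥ B.mulVec y0 with hmdef
  refine ⟨m / d, by positivity, fun y => ?_⟩
  have h1 : m * ‖y‖ ^ 2 ≤ y ⬝ᵥ B.mulVec y := by
    by_cases hy : y = 0
    · subst hy; simp
    · have hn : 0 < ‖y‖ := norm_pos_iff.mpr hy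
      have hs : (‖y‖⁻¹ • y) ∈ Metric.sphere (0 : Fin d → ℝ) 1 := by
        simp [norm_smul, hn.ne']
      have := hmin hs
      simp only [Set.mem_ofPred_eq, mulVec_smul, dotProduct_smul, smul_dotProduct, smul_eq_mul] at this
      rw [← hmdef] at this
      have h2 : y ⬝ᵥ B.mulVec y = ‖y‖ ^ 2 * (‖y‖⁻¹ * (‖y‖⁻¹ * y ⬝ᵥ B.mulVec y)) := by
        field_simp
      rw [h2, mul_comm]
      gcongr
  have h2 : ∑ i, y i ^ 2 ≤ d * ‖y‖ ^ 2 := by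
    calc ∑ i, y i ^ 2 ≤ ∑ i : Fin d, ‖y‖ ^ 2 := by
          apply Finset.sum_le_sum
          intro i _
          rw [← sq_abs]
          have := norm_le_pi_norm y i
          rw [Real.norm_eq_abs] at this
          gcongr
      _ = _ := by simp
  calc m / d * ∑ i, y i ^ 2 ≤ m / d * (d * ‖y‖ ^ 2) := by gcongr
    _ = m * ‖y‖ ^ 2 := by field_simp
    _ ≤ _ := h1

theorem qp_dual {d : ℕ} [NeZero d] (A : Matrix (Fin d) (Fin d) ℝ) (hA : A.PosDef)
    (c bt : Fin d → ℝ) (I : Finset (Fin d)) (hI : IsQPIndex A c bt I) (h1I : (0 : Fin d) ∈ I) :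
    (∀ i ∈ I, 0 < (A⁻¹.mulVec bt) i) ∧ (∀ i, i ∉ I → (A⁻¹.mulVec bt) i = 0) ∧
      eDot A c I 0 = (A⁻¹.mulVec bt) 0 := by
  obtain ⟨-, hbt, hpos, hoff⟩ := hI
  set w := (subM A I I)⁻¹.mulVec (subV c I) with hw
  have hS : (subM A I I).PosDef := by
    have := hA.submatrix (e := fun i : ↥I => (i : Fin d)) Subtype.val_injective
    exact this
  have hSu : IsUnit (subM A I I).det := (Matrix.isUnit_iff_isUnit_det _).1 hS.isUnit
  have hAu : IsUnit A.det := (Matrix.isUnit_iff_isUnit_det _).1 hA.isUnit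
  let lam : Fin d → ℝ := fun i => if h : i ∈ I then w ⟨i, h⟩ else 0
  have key : ∀ j, (A.mulVec lam) j = (fun i : ↥I => A j i) ⬝ᵥ w := by
    intro j
    simp only [mulVec, dotProduct]
    rw [← Finset.sum_subset (Finset.subset_univ I) (by
      intro i _ hi
      simp [lam, hi])]
    rw [← Finset.sum_coe_sort]
    apply Finset.sum_congr rfl
    intro i _
    simp [lam]
  have hAl : A.mulVec lam = bt := by
    ext j
    rw [key]
    by_cases hj : j ∈ I
    · have : ((subM A I I).mulVec w) ⟨j, hj⟩ = c j := by
        rw [hw, mulVec_mulVec, Matrix.mul_nonsing_inv _ hSu, one_mulVec]; rfl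
      rw [hbt j hj, ← this]; rfl
    · rw [hoff j hj]
  have hl : A⁻¹.mulVec bt = lam := by
    rw [← hAl, mulVec_mulVec, Matrix.nonsing_inv_mul _ hAu, one_mulVec]
  rw [hl]
  refine ⟨fun i hi => ?_, fun i hi => by simp [lam, hi], ?_⟩
  · simp only [lam, hi, dif_pos]; exact hpos _
  · have hsym : ((subM A I I)⁻¹)ᵀ = (subM A I I)⁻¹ := by
      have := hS.inv.isHermitian
      simpa [Matrix.IsHermitian] using this
    unfold eDot
    rw [dotProduct_mulVec, ← mulVec_transpose, hsym, ← hw]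
    have : (fun j : ↥I => if (j : Fin d) = 0 then (1 : ℝ) else 0) = Pi.single ⟨0, h1I⟩ 1 := by
      ext j
      simp [Pi.single_apply, Subtype.ext_iff]
    rw [this]
    simp [lam, h1I]

theorem fubini0 {d : ℕ} [NeZero d] (G : (Fin d → ℝ) → ℝ) :
    ∃ K : ℝ, ∀ φ : ℝ → ℝ,
      ∫ z : Fin d → ℝ, φ (z 0) * G (Function.update z 0 0) = (∫ t, φ t) * K := by
  obtain _ | n := d
  · exact absurd rfl (NeZero.ne 0)
  refine ⟨∫ y : Fin n → ℝ, G (Fin.cons 0 y), fun φ => ?_⟩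
  have hmp := (volume_preserving_piFinSuccAbove (fun _ : Fin (n + 1) => ℝ) 0)
  rw [← integral_prod_mul, ← Measure.volume_eq_prod, ← hmp.integral_comp (MeasurableEquiv.measurableEmbedding _)]
  congr 1
  ext z
  congr 2
  ext i
  refine Fin.cases ?_ (fun j => ?_) i
  · simp
  · simp [MeasurableEquiv.piFinSuccAbove, Fin.insertNthEquiv, Fin.tail]

theorem change_var {d : ℕ} (a s : Fin d → ℝ) (hs : ∀ i, s i ≠ 0) :
    ∃ C : ℝ, 0 < C ∧ ∀ g : (Fin d → ℝ) → ℝ, Measurable g →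
      ∫ x, g x = C * ∫ z : Fin d → ℝ, g (fun i => a i + s i * z i) := by
  have hdet : det (diagonal s) ≠ 0 := by
    rw [det_diagonal]; exact Finset.prod_ne_zero_iff.2 fun i _ => hs i
  have h := Real.smul_map_diagonal_volume_pi hdet
  refine ⟨|det (diagonal s)|, by positivity, fun g hg => ?_⟩
  rw [← integral_add_left_eq_self g a]
  conv_lhs => rw [← h]
  rw [integral_smul_measure, integral_map, ENNReal.toReal_ofReal (abs_nonneg _), smul_eq_mul]
  · congr 2
    ext z
    congr 1
    ext i
    simp [mulVec_diagonal]
  · exact (LinearMap.continuous_of_finiteDimensional _).measurable.aemeasurable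
  · exact (hg.comp (measurable_const_add a)).aestronglyMeasurable

def yv {d : ℕ} [NeZero d] (I : Finset (Fin d)) (μ s : ℝ) (z : Fin d → ℝ) : Fin d → ℝ :=
  fun i => (if i = 0 then μ else 0) + (if i ∈ I then s else 1) * z i

def ff {d : ℕ} [NeZero d] (lam : Fin d → ℝ) (B : Matrix (Fin d) (Fin d) ℝ) (I : Finset (Fin d))
    (μ s : ℝ) (z : Fin d → ℝ) : ℝ :=
  Real.exp (-(lam ⬝ᵥ z)) * Real.exp (-(yv I μ s z ⬝ᵥ B.mulVec (yv I μ s z)) / 2)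

def RR {d : ℕ} (c bt : Fin d → ℝ) (u : ℝ) : Set (Fin d → ℝ) :=
  {z | ∀ i, (c i - bt i) * u < z i}

def Rinf {d : ℕ} (c bt : Fin d → ℝ) : Set (Fin d → ℝ) :=
  {z | ∀ i, bt i = c i → 0 < z i}

def kk {d : ℕ} [NeZero d] (w : ℝ → ℝ) (lam : Fin d → ℝ) (κ : ℝ) (I : Finset (Fin d))
    (i : Fin d) (t : ℝ) : ℝ :=
  if i ∈ I then
    (Set.Ioi (0 : ℝ)).indicator (fun t => (if i = 0 then |w t| else 1) * Real.exp (-(lam i * t))) t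
  else Real.exp (-(κ / 2) * t ^ 2)

theorem kk_nonneg {d : ℕ} [NeZero d] (w : ℝ → ℝ) (lam : Fin d → ℝ) (κ : ℝ) (I : Finset (Fin d))
    (i : Fin d) (t : ℝ) : 0 ≤ kk w lam κ I i t := by
  unfold kk
  split_ifs
  · apply Set.indicator_nonneg
    intro t _
    positivity
  · apply Set.indicator_nonneg
    intro t _
    positivity
  · positivity

theorem kk_integrable {d : ℕ} [NeZero d] (w : ℝ → ℝ) (lam : Fin d → ℝ) (κ : ℝ) (hκ : 0 < κ)
    (I : Finset (Fin d)) (hlam : ∀ i ∈ I, 0 < lam i)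
    (hw : IntegrableOn (fun t => w t * Real.exp (-(lam 0 * t))) (Set.Ioi 0)) :
    Integrable (fun z : Fin d → ℝ => ∏ i, kk w lam κ I i (z i)) := by
  apply Integrable.fintype_prod (f := fun i => kk w lam κ I i)
  intro i
  by_cases hi : i ∈ I
  · have : kk w lam κ I i = (Set.Ioi (0 : ℝ)).indicator
        (fun t => (if i = 0 then |w t| else 1) * Real.exp (-(lam i * t))) := by
      ext t; simp [kk, hi]
    rw [this, integrable_indicator_iff measurableSet_Ioi]
    by_cases h0 : i = 0
    · subst h0
      have := hw.abs
      simp only [abs_mul, Real.abs_exp] at this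
      simp only [if_true]
      exact this
    · have := exp_neg_integrableOn_Ioi 0 (hlam i hi)
      simpa [h0] using this
  · have : kk w lam κ I i = fun t => Real.exp (-(κ / 2) * t ^ 2) := by
      ext t; simp [kk, hi]
    rw [this]
    exact integrable_exp_neg_mul_sq (by positivity)

theorem dom_bound {d : ℕ} [NeZero d] (w : ℝ → ℝ) (lam : Fin d → ℝ) (κ : ℝ) (hκ : 0 < κ)
    (I : Finset (Fin d)) (h0I : (0 : Fin d) ∈ I) (hlam0 : ∀ i, i ∉ I → lam i = 0)
    (B : Matrix (Fin d) (Fin d) ℝ)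
    (hB : ∀ y : Fin d → ℝ, κ * ∑ i, y i ^ 2 ≤ y ⬝ᵥ B.mulVec y) (μ s : ℝ) (z : Fin d → ℝ)
    (hz : ∀ i ∈ I, 0 < z i) :
    |w (z 0) * ff lam B I μ s z| ≤ ∏ i, kk w lam κ I i (z i) := by
  have hk : ∀ i, kk w lam κ I i (z i) = (if i = 0 then |w (z 0)| else 1) *
      Real.exp (if i ∈ I then -(lam i * z i) else -(κ / 2) * z i ^ 2) := by
    intro i
    by_cases hi : i ∈ I
    · have := hz i hi
      by_cases h0 : i = 0
      · subst h0; simp [kk, hi, this]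
      · simp [kk, hi, this, h0]
    · have h0 : i ≠ 0 := by rintro rfl; exact hi h0I
      simp [kk, hi, h0]
  simp_rw [hk]
  rw [Finset.prod_mul_distrib, ← Real.exp_sum, Finset.prod_ite_eq' Finset.univ 0, abs_mul]
  simp only [Finset.mem_univ, if_true]
  gcongr
  have hff : 0 < ff lam B I μ s z := by unfold ff; positivity
  rw [abs_of_pos hff, ff, ← Real.exp_add]
  apply Real.exp_le_exp.2
  have h1 := hB (yv I μ s z)
  have h2 : ∑ i, (if i ∈ I then 0 else z i ^ 2) ≤ ∑ i, yv I μ s z i ^ 2 := by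
    apply Finset.sum_le_sum
    intro i _
    by_cases hi : i ∈ I
    · simp only [hi, if_true]; positivity
    · have h0 : i ≠ 0 := by rintro rfl; exact hi h0I
      simp [yv, hi, h0]
  have h3 : ∑ i, (if i ∈ I then -(lam i * z i) else -(κ / 2) * z i ^ 2) =
      -(lam ⬝ᵥ z) - κ / 2 * ∑ i, (if i ∈ I then 0 else z i ^ 2) := by
    rw [Finset.mul_sum, dotProduct, ← Finset.sum_neg_distrib, ← Finset.sum_sub_distrib]
    apply Finset.sum_congr rfl
    intro i _
    by_cases hi : i ∈ I
    · simp [hi]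
    · simp [hi, hlam0 i hi]
  rw [h3]
  have h4 := mul_le_mul_of_nonneg_left h2 hκ.le
  linarith

theorem ff_cont {d : ℕ} [NeZero d] (lam : Fin d → ℝ) (B : Matrix (Fin d) (Fin d) ℝ)
    (I : Finset (Fin d)) (μ : ℝ) :
    Continuous fun p : ℝ × (Fin d → ℝ) => ff lam B I μ p.1 p.2 := by
  have hy : Continuous fun p : ℝ × (Fin d → ℝ) => yv I μ p.1 p.2 := by
    unfold yv
    apply continuous_pi
    intro i
    by_cases hi : i ∈ I
    · simp only [hi, if_true]; fun_prop
    · simp only [hi, if_false]; fun_prop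
  unfold ff
  fun_prop

theorem RR_meas {d : ℕ} (c bt : Fin d → ℝ) (u : ℝ) : MeasurableSet (RR c bt u) := by
  unfold RR
  simp only [Set.ofPred_forall]
  exact MeasurableSet.iInter fun i => measurableSet_lt measurable_const (measurable_pi_apply i)

theorem Rinf_open {d : ℕ} (c bt : Fin d → ℝ) : IsOpen (Rinf c bt) := by
  unfold Rinf
  simp only [Set.ofPred_forall]
  refine isOpen_iInter_of_finite fun i => ?_
  by_cases h : bt i = c i
  · simpa [h] using isOpen_lt continuous_const (continuous_apply i)
  · simp [h]

theorem lim_main {d : ℕ} [NeZero d] (w : ℝ → ℝ) (hwc : Continuous w) (lam : Fin d → ℝ)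
    (I : Finset (Fin d)) (h0I : (0 : Fin d) ∈ I) (hlam : ∀ i ∈ I, 0 < lam i)
    (hlam0 : ∀ i, i ∉ I → lam i = 0)
    (B : Matrix (Fin d) (Fin d) ℝ) (hB : B.PosDef) (μ : ℝ) (c bt : Fin d → ℝ)
    (hcb : ∀ i, c i ≤ bt i) (hbI : ∀ i ∈ I, bt i = c i)
    (hw : IntegrableOn (fun t => w t * Real.exp (-(lam 0 * t))) (Set.Ioi 0)) :
    Integrable ((Rinf c bt).indicator (fun z => w (z 0) * ff lam B I μ 0 z)) ∧
    Tendsto (fun u : ℝ => ∫ z, (RR c bt u).indicator (fun z => w (z 0) * ff lam B I μ u⁻¹ z) z)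
      atTop (𝓝 (∫ z, (Rinf c bt).indicator (fun z => w (z 0) * ff lam B I μ 0 z) z)) := by
  obtain ⟨κ, hκ, hBκ⟩ := quad_coercive B hB
  have hint := kk_integrable w lam κ hκ I hlam hw
  have hcts : ∀ s, Continuous fun z : Fin d → ℝ => w (z 0) * ff lam B I μ s z := by
    intro s
    have := (ff_cont lam B I μ).comp (Continuous.prodMk_right s)
    exact (hwc.comp (continuous_apply 0)).mul this
  have hdom : ∀ (S : Set (Fin d → ℝ)), (∀ z ∈ S, ∀ i ∈ I, 0 < z i) → ∀ s z,
      ‖S.indicator (fun z => w (z 0) * ff lam B I μ s z) z‖ ≤ ∏ i, kk w lam κ I i (z i) := by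
    intro S hS s z
    by_cases hz : z ∈ S
    · rw [Set.indicator_of_mem hz, Real.norm_eq_abs]
      exact dom_bound w lam κ hκ I h0I hlam0 B hBκ μ s z (hS z hz)
    · rw [Set.indicator_of_notMem hz, norm_zero]
      exact Finset.prod_nonneg fun i _ => kk_nonneg _ _ _ _ _ _
  have hRI : ∀ u, ∀ z ∈ RR c bt u, ∀ i ∈ I, 0 < z i := by
    intro u z hz i hi
    have := hz i
    rw [hbI i hi] at this
    simpa using this
  have hRI' : ∀ z ∈ Rinf c bt, ∀ i ∈ I, 0 < z i := fun z hz i hi => hz i (hbI i hi)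
  refine ⟨?_, ?_⟩
  · refine hint.mono' ?_ (Eventually.of_forall (hdom _ hRI' 0))
    exact ((hcts 0).measurable.indicator (Rinf_open c bt).measurableSet).aestronglyMeasurable
  · refine tendsto_integral_filter_of_dominated_convergence _ ?_ ?_ hint ?_
    · exact Eventually.of_forall fun u =>
        ((hcts _).measurable.indicator (RR_meas c bt u)).aestronglyMeasurable
    · exact Eventually.of_forall fun u => Eventually.of_forall (hdom _ (hRI u) _)
    · refine Eventually.of_forall fun z => ?_
      have hmem : ∀ᶠ u in atTop, (z ∈ RR c bt u ↔ z ∈ Rinf c bt) := by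
        have h1 : ∀ᶠ u : ℝ in atTop, ∀ i, ((c i - bt i) * u < z i ↔ (bt i = c i → 0 < z i)) := by
          rw [Filter.eventually_all]
          intro i
          by_cases h : bt i = c i
          · simp [h]
          · have hlt : c i - bt i < 0 := by
              have := lt_of_le_of_ne (hcb i) (Ne.symm h)
              linarith
            have := (tendsto_id (α := ℝ) (x := atTop)).const_mul_atTop_of_neg hlt
            filter_upwards [this.eventually_lt_atBot (z i)] with u hu
            simp only [h, false_imp_iff, iff_true]
            exact hu
        filter_upwards [h1] with u hu
        exact forall_congr' hu
      have hlim : Tendsto (fun u : ℝ => w (z 0) * ff lam B I μ u⁻¹ z) atTop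
          (𝓝 (w (z 0) * ff lam B I μ 0 z)) := by
        apply Tendsto.const_mul
        have hc : Continuous fun s : ℝ => ff lam B I μ s z :=
          (ff_cont lam B I μ).comp (Continuous.prodMk_left z)
        exact (hc.tendsto 0).comp tendsto_inv_atTop_zero
      by_cases hz : z ∈ Rinf c bt
      · rw [Set.indicator_of_mem hz]
        refine hlim.congr' ?_
        filter_upwards [hmem] with u hu
        rw [Set.indicator_of_mem (hu.2 hz)]
      · rw [Set.indicator_of_notMem hz]
        refine tendsto_const_nhds.congr' ?_
        filter_upwards [hmem] with u hu
        rw [Set.indicator_of_notMem (fun h => hz (hu.1 h))]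

theorem lim_factor {d : ℕ} [NeZero d] (lam : Fin d → ℝ)
    (I : Finset (Fin d)) (h0I : (0 : Fin d) ∈ I)
    (B : Matrix (Fin d) (Fin d) ℝ) (μ : ℝ) (c bt : Fin d → ℝ) (hb0 : bt 0 = c 0) :
    ∃ K : ℝ, ∀ w : ℝ → ℝ,
      ∫ z, (Rinf c bt).indicator (fun z => w (z 0) * ff lam B I μ 0 z) z =
        (∫ t in Set.Ioi (0 : ℝ), w t * Real.exp (-(lam 0 * t))) * K := by
  obtain ⟨K, hK⟩ := fubini0 (d := d) (fun z => {z : Fin d → ℝ | ∀ i, i ≠ 0 → bt i = c i → 0 < z i}.indicator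
    (ff lam B I μ 0) z)
  refine ⟨K, fun w => ?_⟩
  rw [← integral_indicator measurableSet_Ioi, ← hK]
  congr 1
  ext z
  have hy : yv I μ 0 (Function.update z 0 0) = yv I μ 0 z := by
    ext i
    by_cases h : i = 0
    · subst h; simp [yv, h0I]
    · simp [yv, h]
  have hf : ff lam B I μ 0 z = Real.exp (-(lam 0 * z 0)) * ff lam B I μ 0 (Function.update z 0 0) := by
    unfold ff
    rw [hy]
    simp only [← Real.exp_add]
    have : lam ⬝ᵥ z = lam 0 * z 0 + lam ⬝ᵥ Function.update z 0 0 := by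
      have hz : z = Pi.single 0 (z 0) + Function.update z 0 0 := by
        ext i
        by_cases h : i = 0
        · subst h; simp
        · simp [h]
      conv_lhs => rw [hz]
      rw [dotProduct_add, dotProduct_single]
    rw [this]; congr 1; ring
  have hmem : z ∈ Rinf c bt ↔ (0 < z 0 ∧ Function.update z 0 0 ∈
      {z : Fin d → ℝ | ∀ i, i ≠ 0 → bt i = c i → 0 < z i}) := by
    constructor
    · intro h
      refine ⟨h 0 hb0, fun i hi hb => ?_⟩
      rw [Function.update_of_ne hi]
      exact h i hb
    · rintro ⟨h0, h⟩ i hb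
      by_cases hi : i = 0
      · subst hi; exact h0
      · have := h i hi hb
        rwa [Function.update_of_ne hi] at this
  by_cases h0 : 0 < z 0
  · by_cases h1 : Function.update z 0 0 ∈ {z : Fin d → ℝ | ∀ i, i ≠ 0 → bt i = c i → 0 < z i}
    · rw [Set.indicator_of_mem (hmem.2 ⟨h0, h1⟩), Set.indicator_of_mem (Set.mem_Ioi.2 h0),
        Set.indicator_of_mem h1, hf]
      ring
    · rw [Set.indicator_of_notMem (fun h => h1 (hmem.1 h).2), Set.indicator_of_notMem h1, mul_zero]
  · rw [Set.indicator_of_notMem (fun h => h0 (hmem.1 h).1), Set.indicator_of_notMem (s := Set.Ioi (0 : ℝ)) h0,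
      zero_mul]

theorem one_dim (l : ℝ) (hl : 0 < l) :
    IntegrableOn (fun t => (1 : ℝ) * Real.exp (-(l * t))) (Set.Ioi 0) ∧
    IntegrableOn (fun t => t * Real.exp (-(l * t))) (Set.Ioi 0) ∧
    (∫ t in Set.Ioi (0 : ℝ), (1 : ℝ) * Real.exp (-(l * t))) = 1 / l ∧
    (∫ t in Set.Ioi (0 : ℝ), t * Real.exp (-(l * t))) = 1 / l ^ 2 := by
  refine ⟨?_, ?_, ?_, ?_⟩
  · simpa using exp_neg_integrableOn_Ioi 0 hl
  · have := integrableOn_rpow_mul_exp_neg_mul_rpow (p := 1) (s := 1) (b := l) (by norm_num)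
      (by norm_num) hl
    simpa using this
  · have := integral_exp_mul_Ioi (a := -l) (by linarith) 0
    simpa using this
  · have := Real.integral_rpow_mul_exp_neg_mul_Ioi (a := 2) (r := l) (by norm_num) hl
    norm_num at this
    simpa using this

theorem law_int {Ω : Type*} [MeasurableSpace Ω] (P : Measure Ω)
    {d : ℕ} (A : Matrix (Fin d) (Fin d) ℝ)
    (X : Ω → Fin d → ℝ) (hX : Measurable X) (hG : IsCenteredGaussianRV P X A)
    (g : (Fin d → ℝ) → ℝ) (hg : Measurable g) :
    ∫ ω, g (X ω) ∂P = ∫ x, gaussPDF A x * g x := by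
  have hm : Measurable (gaussPDF A) := by
    unfold gaussPDF
    have : Continuous fun x : Fin d → ℝ => x ⬝ᵥ A⁻¹.mulVec x := by fun_prop
    fun_prop
  have hpos : ∀ x, 0 ≤ gaussPDF A x := by
    intro x; unfold gaussPDF; positivity
  rw [← integral_map hX.aemeasurable hg.aestronglyMeasurable, hG,
    integral_withDensity_eq_integral_toReal_smul hm.ennreal_ofReal
      (Eventually.of_forall fun x => ENNReal.ofReal_lt_top)]
  congr 1
  ext x
  rw [ENNReal.toReal_ofReal (hpos x), smul_eq_mul]

def DD {d : ℕ} [NeZero d] (c : Fin d → ℝ) (μ u : ℝ) : Set (Fin d → ℝ) :=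
  {x | c 0 * u + μ < x 0 ∧ ∀ i : Fin d, i ≠ 0 → c i * u < x i}

theorem DD_meas {d : ℕ} [NeZero d] (c : Fin d → ℝ) (μ u : ℝ) : MeasurableSet (DD c μ u) := by
  unfold DD
  refine MeasurableSet.inter (measurableSet_lt measurable_const (measurable_pi_apply 0)) ?_
  change MeasurableSet {x : Fin d → ℝ | ∀ i : Fin d, i ≠ 0 → c i * u < x i}
  simp only [Set.ofPred_forall]
  exact MeasurableSet.iInter fun i => MeasurableSet.iInter fun _ =>
    measurableSet_lt measurable_const (measurable_pi_apply i)

theorem exp_key {Ω : Type*} [MeasurableSpace Ω] (P : Measure Ω)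
    {d : ℕ} [NeZero d] (A : Matrix (Fin d) (Fin d) ℝ) (hA : A.PosDef)
    (X : Ω → Fin d → ℝ) (hX : Measurable X) (hG : IsCenteredGaussianRV P X A)
    (μ : ℝ) (c bt : Fin d → ℝ) (I : Finset (Fin d)) (h0I : (0 : Fin d) ∈ I)
    (hbI : ∀ i ∈ I, bt i = c i) (hlam0 : ∀ i, i ∉ I → (A⁻¹.mulVec bt) i = 0)
    (u : ℝ) (hu : 0 < u) :
    ∃ C : ℝ, 0 < C ∧ ∀ w : ℝ → ℝ, Continuous w →
      ∫ ω, (DD c μ u).indicator (fun x => w (u * (x 0 - c 0 * u - μ))) (X ω) ∂P =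
        C * ∫ z, (RR c bt u).indicator (fun z => w (z 0) * ff (A⁻¹.mulVec bt) A⁻¹ I μ u⁻¹ z) z := by
  set lam := A⁻¹.mulVec bt with hlam
  have hui : u ≠ 0 := hu.ne'
  obtain ⟨C, hC, hcv⟩ := change_var (fun i => bt i * u + (if i = 0 then μ else 0))
    (fun i => if i ∈ I then u⁻¹ else 1) (by intro i; split_ifs <;> simp [hui])
  have hN : 0 < (Real.sqrt ((2 * Real.pi) ^ Fintype.card (Fin d) * A.det))⁻¹ := by
    have := hA.det_pos
    positivity
  set N := (Real.sqrt ((2 * Real.pi) ^ Fintype.card (Fin d) * A.det))⁻¹ with hNdef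
  set M := N * Real.exp (-(u ^ 2 * (bt ⬝ᵥ lam)) / 2 - u * (lam 0 * μ)) with hM
  have hsym : (A⁻¹)ᵀ = A⁻¹ := by
    have := hA.inv.isHermitian
    simpa [Matrix.IsHermitian] using this
  have hpdf : ∀ z : Fin d → ℝ, gaussPDF A (fun i => bt i * u + (if i = 0 then μ else 0) +
      (if i ∈ I then u⁻¹ else 1) * z i) = M * ff lam A⁻¹ I μ u⁻¹ z := by
    intro z
    have hx : (fun i => bt i * u + (if i = 0 then μ else 0) +
      (if i ∈ I then u⁻¹ else 1) * z i) = u • bt + yv I μ u⁻¹ z := by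
      ext i; simp [yv]; ring
    rw [hx]
    set y := yv I μ u⁻¹ z with hy
    have h1 : bt ⬝ᵥ A⁻¹.mulVec y = lam ⬝ᵥ y := by
      rw [dotProduct_mulVec, ← mulVec_transpose, hsym]
    have h2 : u * (lam ⬝ᵥ y) = u * (lam 0 * μ) + lam ⬝ᵥ z := by
      simp only [dotProduct, Finset.mul_sum]
      have : lam 0 * μ = ∑ i, if i = 0 then lam i * μ else 0 := by simp
      rw [this, Finset.mul_sum, ← Finset.sum_add_distrib]
      apply Finset.sum_congr rfl
      intro i _
      by_cases hi : i ∈ I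
      · by_cases h : i = 0
        · subst h; simp [hy, yv, hi]; field_simp
        · simp [hy, yv, hi, h]; field_simp
      · have h : i ≠ 0 := by rintro rfl; exact hi h0I
        simp [hy, yv, hi, h, hlam0 i hi]
    unfold gaussPDF ff
    rw [← hNdef, hM, mul_assoc, ← Real.exp_add, ← Real.exp_add]
    congr 2
    simp only [mulVec_add, mulVec_smul, dotProduct_add, add_dotProduct, smul_dotProduct,
      dotProduct_smul, smul_eq_mul, h1, ← hlam, dotProduct_comm y lam, ← hy]
    linear_combination (-1) * h2
  have hmem : ∀ z : Fin d → ℝ, ((fun i => bt i * u + (if i = 0 then μ else 0) +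
      (if i ∈ I then u⁻¹ else 1) * z i) ∈ DD c μ u ↔ z ∈ RR c bt u) := by
    intro z
    have hi : ∀ i, i ∈ I → ((c i - bt i) * u < z i ↔ c i * u < bt i * u + u⁻¹ * z i) := by
      intro i hi
      rw [hbI i hi, sub_self, zero_mul, lt_add_iff_pos_right]
      constructor
      · intro h; positivity
      · intro h; exact (pos_iff_pos_of_mul_pos h).1 (by positivity)
    have hj : ∀ i, i ∉ I → ((c i - bt i) * u < z i ↔ c i * u < bt i * u + 1 * z i) := by
      intro i hi
      constructor <;> intro h <;> linarith
    constructor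
    · rintro ⟨h0, h⟩ i
      by_cases hi0 : i = 0
      · subst hi0
        rw [hi 0 h0I]
        simp only [h0I, if_true] at h0
        linarith
      · have := h i hi0
        by_cases hI : i ∈ I
        · rw [hi i hI]; simpa [hi0, hI] using this
        · rw [hj i hI]; simpa [hi0, hI] using this
    · intro h
      refine ⟨?_, fun i hi0 => ?_⟩
      · have := (hi 0 h0I).1 (h 0)
        simp only [h0I, if_true]
        linarith
      · by_cases hI : i ∈ I
        · simpa [hi0, hI] using (hi i hI).1 (h i)
        · simpa [hi0, hI] using (hj i hI).1 (h i)
  refine ⟨C * M, by positivity, fun w hw => ?_⟩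
  have hgm : Measurable ((DD c μ u).indicator
      (fun x : Fin d → ℝ => w (u * (x 0 - c 0 * u - μ)))) := by
    refine Measurable.indicator ?_ (DD_meas c μ u)
    fun_prop
  have hm : Measurable (gaussPDF A) := by
    unfold gaussPDF
    have : Continuous fun x : Fin d → ℝ => x ⬝ᵥ A⁻¹.mulVec x := by fun_prop
    fun_prop
  rw [law_int P A X hX hG _ hgm, hcv (fun x => gaussPDF A x * (DD c μ u).indicator
    (fun x => w (u * (x 0 - c 0 * u - μ))) x) (hm.mul hgm), mul_assoc, ← integral_const_mul M]
  congr 2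
  ext z
  rw [hpdf z]
  by_cases hz : z ∈ RR c bt u
  · rw [Set.indicator_of_mem hz, Set.indicator_of_mem ((hmem z).2 hz)]
    have : u * (bt 0 * u + (if (0 : Fin d) = 0 then μ else 0) +
      (if (0 : Fin d) ∈ I then u⁻¹ else 1) * z 0 - c 0 * u - μ) = z 0 := by
      simp only [h0I, if_true, hbI 0 h0I]
      field_simp
      ring
    rw [this]; ring
  · rw [Set.indicator_of_notMem hz, Set.indicator_of_notMem (fun h => hz ((hmem z).1 h))]
    ring

/-- Theorem 2.1 i): if `1 ∈ I`, then as `u → ∞`,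
`E(c,u) ~ (1/(c_I ⬝ (Σ_II)⁻¹ e_1)) ⬝ P(X_1 > c_1 u + μ, X_{-1} > c_{-1} u)/(u P(X_{-1} > c_{-1} u))`;
in particular `E(c,u) → 0`. -/
theorem mme_multivariate_gaussian_case_i
    {Ω : Type*} [MeasurableSpace Ω] (P : Measure Ω) [IsProbabilityMeasure P]
    {d : ℕ} [NeZero d] (A : Matrix (Fin d) (Fin d) ℝ) (hA : A.PosDef)
    (hcorr : ∀ i, A i i = 1)
    (X : Ω → Fin d → ℝ) (hX : Measurable X) (hG : IsCenteredGaussianRV P X A)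
    (μ : ℝ) (c : Fin d → ℝ) (hc : ∃ i, 0 < c i)
    (bt : Fin d → ℝ) (I L : Finset (Fin d))
    (hsol : IsQPSol A c bt) (hI : IsQPIndex A c bt I) (hL : ∀ i, i ∈ L ↔ bt i = c i)
    (h1I : (0 : Fin d) ∈ I) :
    Tendsto (fun u => mmeV P X c μ u /
        (1 / eDot A c I 0 *
          ((P {ω | c 0 * u + μ < X ω 0 ∧ ∀ i : Fin d, i ≠ 0 → c i * u < X ω i}).toReal /
            (u * (P (tailEvent X c u)).toReal))))
      atTop (𝓝 1) ∧
    Tendsto (fun u => mmeV P X c μ u) atTop (𝓝 0) := by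
  classical
  obtain ⟨hlam, hlam0, he⟩ := qp_dual A hA c bt I hI h1I
  have hbI := hI.2.1
  have hcb := hsol.1
  rw [he]
  set lam := A⁻¹.mulVec bt with hlamdef
  have hl0 : 0 < lam 0 := hlam 0 h1I
  obtain ⟨hw1, hwi, hv1, hvi⟩ := one_dim (lam 0) hl0
  obtain ⟨hint1, hlim1⟩ := lim_main (fun _ => (1 : ℝ)) continuous_const lam I h1I hlam hlam0 A⁻¹
    hA.inv μ c bt hcb hbI hw1
  obtain ⟨-, hlim2⟩ := lim_main (fun t => t) continuous_id lam I h1I hlam hlam0 A⁻¹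
    hA.inv μ c bt hcb hbI hwi
  obtain ⟨K, hK⟩ := lim_factor lam I h1I A⁻¹ μ c bt (hbI 0 h1I)
  have hpos : 0 < ∫ z, (Rinf c bt).indicator (fun z => (1 : ℝ) * ff lam A⁻¹ I μ 0 z) z := by
    have hffpos : ∀ z, 0 < ff lam A⁻¹ I μ 0 z := fun z => by unfold ff; positivity
    rw [integral_pos_iff_support_of_nonneg _ hint1]
    · have hsupp : Function.support ((Rinf c bt).indicator
          (fun z => (1 : ℝ) * ff lam A⁻¹ I μ 0 z)) = Rinf c bt := by
        rw [Set.support_indicator]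
        apply Set.inter_eq_left.2
        intro z _
        simp [(hffpos z).ne']
      rw [hsupp]
      refine (Rinf_open c bt).measure_pos _ ⟨fun _ => 1, fun i _ => one_pos⟩
    · intro z
      apply Set.indicator_nonneg
      intro z _
      rw [one_mul]
      exact (hffpos z).le
  rw [hK (fun _ => 1), hv1] at hlim1
  rw [hK (fun _ => 1), hv1] at hpos
  rw [hK (fun t => t), hvi] at hlim2
  have hKne : K ≠ 0 := by rintro rfl; simp at hpos
  set J1 : ℝ → ℝ := fun u => ∫ z, (RR c bt u).indicator
    (fun z => (1 : ℝ) * ff lam A⁻¹ I μ u⁻¹ z) z with hJ1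
  set J2 : ℝ → ℝ := fun u => ∫ z, (RR c bt u).indicator
    (fun z => z 0 * ff lam A⁻¹ I μ u⁻¹ z) z with hJ2
  have hratio : Tendsto (fun u => lam 0 * (J2 u / J1 u)) atTop (𝓝 1) := by
    have := (hlim2.div hlim1 hpos.ne').const_mul (lam 0)
    have h1 : lam 0 * (1 / lam 0 ^ 2 * K / (1 / lam 0 * K)) = 1 := by field_simp
    rw [h1] at this
    exact this
  set Pr : ℝ → ℝ := fun u =>
    (P {ω | c 0 * u + μ < X ω 0 ∧ ∀ i : Fin d, i ≠ 0 → c i * u < X ω i}).toReal with hPr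
  set T : ℝ → ℝ := fun u => (P (tailEvent X c u)).toReal with hT
  have hPrT : ∀ u, Pr u ≤ T u := by
    intro u
    apply ENNReal.toReal_mono (measure_ne_top _ _)
    apply measure_mono
    intro ω h
    exact h.2
  have hTm : ∀ u, MeasurableSet (tailEvent X c u) := by
    intro u
    unfold tailEvent
    simp only [Set.ofPred_forall]
    exact MeasurableSet.iInter fun i => MeasurableSet.iInter fun _ =>
      measurableSet_lt measurable_const ((measurable_pi_apply i).comp hX)
  have hmain : ∀ᶠ u in atTop, 0 < u ∧ 0 < Pr u ∧
      (∫ ω in tailEvent X c u, max (X ω 0 - c 0 * u - μ) 0 ∂P) =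
        Pr u * u⁻¹ * (J2 u / J1 u) := by
    filter_upwards [eventually_gt_atTop (0 : ℝ), hlim1.eventually_const_lt hpos] with u hu hJ
    obtain ⟨C, hC, hCw⟩ := exp_key P A hA X hX hG μ c bt I h1I hbI hlam0 u hu
    have e1 := hCw (fun _ => 1) continuous_const
    have e2 := hCw (fun t => t) continuous_id
    have p1 : ∫ ω, (DD c μ u).indicator (fun _ => (1 : ℝ)) (X ω) ∂P = Pr u := by
      have : (fun ω => (DD c μ u).indicator (fun _ => (1 : ℝ)) (X ω)) =
          (X ⁻¹' (DD c μ u)).indicator 1 := by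
        ext ω; rfl
      rw [this, integral_indicator_one (hX (DD_meas c μ u))]
      rfl
    have p2 : ∫ ω, (DD c μ u).indicator (fun x => u * (x 0 - c 0 * u - μ)) (X ω) ∂P =
        u * ∫ ω in tailEvent X c u, max (X ω 0 - c 0 * u - μ) 0 ∂P := by
      rw [← integral_indicator (hTm u), ← integral_const_mul]
      congr 1
      ext ω
      by_cases h1 : ω ∈ tailEvent X c u
      · rw [Set.indicator_of_mem h1]
        by_cases h2 : c 0 * u + μ < X ω 0
        · have : X ω ∈ DD c μ u := ⟨h2, h1⟩
          rw [Set.indicator_of_mem this, max_eq_left (by linarith)]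
        · rw [Set.indicator_of_notMem (fun h => h2 h.1), max_eq_right (by linarith), mul_zero]
      · rw [Set.indicator_of_notMem h1, Set.indicator_of_notMem (fun h => h1 h.2), mul_zero]
    have e1' : Pr u = C * J1 u := p1.symm.trans e1
    have e2' := p2.symm.trans e2
    change _ = C * J2 u at e2'
    change 0 < J1 u at hJ
    refine ⟨hu, by rw [e1']; positivity, ?_⟩
    rw [e1']
    have hJne := hJ.ne'
    field_simp
    linarith
  constructor
  · refine hratio.congr' ?_
    filter_upwards [hmain] with u ⟨hu, hP, hN⟩
    have hTp : 0 < T u := hP.trans_le (hPrT u)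
    change _ = mmeV P X c μ u / (1 / lam 0 * (Pr u / (u * T u)))
    have : mmeV P X c μ u = Pr u * u⁻¹ * (J2 u / J1 u) / T u := by
      rw [← hN]; rfl
    rw [this]
    have h1 := hu.ne'
    have h2 := hP.ne'
    have h3 := hTp.ne'
    have h4 := hl0.ne'
    generalize J2 u / J1 u = r
    field_simp
  · have hr' : Tendsto (fun u => J2 u / J1 u) atTop (𝓝 (1 / lam 0)) := by
      have := hratio.const_mul (1 / lam 0)
      rw [mul_one] at this
      refine this.congr fun u => ?_
      field_simp
    have hz : Tendsto (fun u : ℝ => u⁻¹ * |J2 u / J1 u|) atTop (𝓝 0) := by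
      have := tendsto_inv_atTop_zero.mul hr'.abs
      rwa [zero_mul] at this
    refine squeeze_zero_norm' ?_ hz
    filter_upwards [hmain] with u ⟨hu, hP, hN⟩
    have hTp : 0 < T u := hP.trans_le (hPrT u)
    have : mmeV P X c μ u = Pr u / T u * (u⁻¹ * (J2 u / J1 u)) := by
      have : mmeV P X c μ u = Pr u * u⁻¹ * (J2 u / J1 u) / T u := by
        rw [← hN]; rfl
      rw [this]; ring
    rw [this, Real.norm_eq_abs, abs_mul, abs_mul, abs_of_pos (inv_pos.2 hu),
      abs_of_pos (div_pos hP hTp)]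
    have h1 : Pr u / T u ≤ 1 := (div_le_one hTp).2 (hPrT u)
    exact mul_le_of_le_one_left (by positivity) h1
end
end
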